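/- Let i ≥ 1, let d ∈ f_i, and let J be an invariant-factor count function for d. Then there is a constant C depending only on d such that for all integers n ≥ 3, |(1/n)·Σ_{m=1}^n J(m) − μ_i·log log n| ≤ C·(log log n)^{1/2}. -/

import Mathlib

open MeasureTheory ProbabilityTheory Filter

noncomputable section

/-- A key encoding the lexicographic order on pairs `(φ(q), q)`; this is a valid
encoding on prime powers since every prime power satisfies `q ≤ 2 * φ(q)`. -/
def ppKey (q : ℕ) : ℕ := 2 * Nat.totient q ^ 2 + q

/-- The `n`-th smallest key of a prime power (0-indexed). -/
def ppNthKey (n : ℕ) : ℕ := Nat.nth (fun k => ∃ q : ℕ, IsPrimePow q ∧ ppKey q = k) n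

/-- The total φ-sequence `q̃_i` (1-indexed): the enumeration of all prime powers
ordered by nondecreasing totient, with ties broken by increasing size. -/
def qt (i : ℕ) : ℕ := sInf {q : ℕ | IsPrimePow q ∧ ppKey q = ppNthKey (i - 1)}

/-- `lcm(q̃_1, …, q̃_i)`. -/
def Lseq (i : ℕ) : ℕ := (Finset.Icc 1 i).lcm qt

/-- The universal factor order set `f_i`. -/
def UFO (i : ℕ) : Set ℕ :=
  if Nat.totient (qt i) < Nat.totient (qt (i + 1)) then {Lseq i}
  else {Lseq i, Nat.lcm (Lseq (i - 1)) (qt (i + 1))}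

/-- `φ(q̃_i)` as a real number. -/
def phiQ (i : ℕ) : ℝ := (Nat.totient (qt i) : ℝ)

/-- `μ_i = 1/φ(q̃_i) − 1/φ(q̃_{i+1})`. -/
def muSeq (i : ℕ) : ℝ := 1 / phiQ i - 1 / phiQ (i + 1)

/-- `σ_i = (1/φ(q̃_i) + 1/φ(q̃_{i+1}) − 2/(φ(q̃_i)·φ(q̃_{i+1})))^{1/2}`. -/
def sigSeq (i : ℕ) : ℝ :=
  Real.sqrt (1 / phiQ i + 1 / phiQ (i + 1) - 2 / (phiQ i * phiQ (i + 1)))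

/-- `σ_{i;a,b} = (φ(q̃_i)^{−a} + φ(q̃_{i+1})^{−b} − 2/(φ(q̃_i)·φ(q̃_{i+1})))^{1/2}`. -/
def sigAB (i a b : ℕ) : ℝ :=
  Real.sqrt (1 / phiQ i ^ a + 1 / phiQ (i + 1) ^ b - 2 / (phiQ i * phiQ (i + 1)))

/-- `ν_j = (φ(q̃_j)^{−1}·(1 − φ(q̃_j)^{−1}))^{1/2}`. -/
def nuSeq (j : ℕ) : ℝ := Real.sqrt (1 / phiQ j * (1 - 1 / phiQ j))

/-- `J` is an invariant-factor count function for `d`: whenever `(ℤ/mℤ)ˣ` is isomorphic to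
a direct product of cyclic groups `ℤ/λ_1 × ⋯ × ℤ/λ_K` with `1 < λ_1 ∣ λ_2 ∣ ⋯ ∣ λ_K`,
`J m` is the number of indices `j` with `λ_j = d`. -/
def IsInvCount (d : ℕ) (J : ℕ → ℕ) : Prop :=
  ∀ m : ℕ, 1 ≤ m → ∀ K : ℕ, ∀ lam : Fin K → ℕ,
    (∀ j, 1 < lam j) →
    (∀ j k : Fin K, j ≤ k → lam j ∣ lam k) →
    Nonempty ((ZMod m)ˣ ≃* Multiplicative (∀ j : Fin K, ZMod (lam j))) →
    J m = (Finset.univ.filter fun j : Fin K => lam j = d).card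

/-- The number of `m ∈ {1, …, n}` satisfying `P`. -/
def cnt (P : ℕ → Prop) (n : ℕ) : ℕ := {m : ℕ | 1 ≤ m ∧ m ≤ n ∧ P m}.ncard

/-- The average `(1/n)·∑_{m=1}^n J(m)`. -/
def avg (J : ℕ → ℕ) (n : ℕ) : ℝ := (∑ m ∈ Finset.Icc 1 n, (J m : ℝ)) / n

/-- `log log n`. -/
def LL (n : ℕ) : ℝ := Real.log (Real.log n)

/-- The standard normal cumulative distribution function. -/
def Phi (x : ℝ) : ℝ := (Real.sqrt (2 * Real.pi))⁻¹ * ∫ t in Set.Iic x, Real.exp (-t ^ 2 / 2)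

/-- Owen's T-function. -/
def OwenT (h a : ℝ) : ℝ :=
  (2 * Real.pi)⁻¹ * ∫ t in (0:ℝ)..a, Real.exp (-(1 + t ^ 2) * h ^ 2 / 2) / (1 + t ^ 2)

/-- The skew-normal cumulative distribution function with parameter `α`. -/
def PhiSkew (x α : ℝ) : ℝ := Phi x - 2 * OwenT x α

/-- The standard Gaussian probability measure `γ^k` on `ℝ^k`. -/
def stdGaussian (k : ℕ) : Measure (Fin k → ℝ) :=
  Measure.pi fun _ => gaussianReal 0 1

/-- `ω(m;q,1)`: the number of distinct primes `p ∣ m` with `p ≡ 1 (mod q)`. -/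
def omegaQ (m q : ℕ) : ℕ := (m.primeFactors.filter fun p => p % q = 1 % q).card

/-- The correction term `Ē(m;p^α)`. -/
def Ebar (m p α : ℕ) : ℕ :=
  if p ^ α = 2 ∧ 8 ∣ m then 2
  else if p ^ α = 2 ∧ 4 ∣ m ∧ ¬(8 ∣ m) then 1
  else if p = 2 ∧ 2 ≤ α ∧ 2 ^ (α + 2) ∣ m then 1
  else if p ≠ 2 ∧ p ^ (α + 1) ∣ m then 1
  else 0

/-- `prm(m;q)` for a prime power `q = p^α`: the unique `k` such that `p^k` is the cardinality
of the subgroup `{x ∈ (ℤ/mℤ)ˣ : x^p = 1 and x = y^{p^{α−1}} for some y}` (obtained here as the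
`p`-adic valuation of that cardinality; note `p = q.minFac` and `p^{α−1} = q / p`). -/
def prm (m q : ℕ) : ℕ :=
  (Nat.card {x : (ZMod m)ˣ // x ^ q.minFac = 1 ∧ ∃ y : (ZMod m)ˣ, y ^ (q / q.minFac) = x}).factorization
    q.minFac

/-- `m` is `y`-typical: for all prime powers `q₁, q₂` with `φ(q₁) ≤ y` and `φ(q₁) < φ(q₂)`
one has `prm(m;q₁) > prm(m;q₂)`. -/
def yTypical (y : ℝ) (m : ℕ) : Prop :=
  ∀ q₁ q₂ : ℕ, IsPrimePow q₁ → IsPrimePow q₂ →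
    (Nat.totient q₁ : ℝ) ≤ y → Nat.totient q₁ < Nat.totient q₂ →
    prm m q₂ < prm m q₁

/-- The primes `p ≤ N` with `p ≡ 1 (mod q)`. -/
def primesOne (q N : ℕ) : Finset ℕ :=
  (Finset.Icc 1 N).filter fun p => p.Prime ∧ p % q = 1 % q

/-- The sum of `1/p` over the primes `p ≤ N` with `p ≡ 1 (mod q)`. -/
def recipSum (q N : ℕ) : ℝ := ∑ p ∈ primesOne q N, (1 / p : ℝ)

lemma prime_of_mem_primesOne {q N p : ℕ} (h : p ∈ primesOne q N) : p.Prime :=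
  (Finset.mem_filter.1 h).2.1

lemma recipSum_nonneg (q N : ℕ) : 0 ≤ recipSum q N :=
  Finset.sum_nonneg fun _ _ => by positivity

lemma filter_dvd_primesOne (q : ℕ) {N m : ℕ} (hm : m ∈ Finset.Icc 1 N) :
    (primesOne q N).filter (· ∣ m) = m.primeFactors.filter fun p => p % q = 1 % q := by
  obtain ⟨h1, h2⟩ := Finset.mem_Icc.1 hm
  ext p
  simp only [primesOne, Finset.mem_filter, Finset.mem_Icc, Nat.mem_primeFactors]
  constructor
  · rintro ⟨⟨_, hp, hq⟩, hd⟩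
    exact ⟨⟨hp, hd, by omega⟩, hq⟩
  · rintro ⟨⟨hp, hd, _⟩, hq⟩
    exact ⟨⟨⟨hp.one_le, (Nat.le_of_dvd h1 hd).trans h2⟩, hp, hq⟩, hd⟩

lemma omegaQ_eq_sum (q : ℕ) {N m : ℕ} (hm : m ∈ Finset.Icc 1 N) :
    (omegaQ m q : ℝ) = ∑ p ∈ primesOne q N, if p ∣ m then (1 : ℝ) else 0 := by
  rw [omegaQ, ← filter_dvd_primesOne q hm, Finset.sum_ite, Finset.sum_const_zero, add_zero,
    Finset.sum_const, nsmul_eq_mul, mul_one]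

lemma card_filter_dvd_Icc (N d : ℕ) : ((Finset.Icc 1 N).filter (d ∣ ·)).card = N / d := by
  rw [← Nat.Ioc_filter_dvd_card_eq_div]
  rfl

lemma sum_dvd_Icc (N d : ℕ) :
    ∑ m ∈ Finset.Icc 1 N, (if d ∣ m then (1 : ℝ) else 0) = ((N / d : ℕ) : ℝ) := by
  rw [Finset.sum_ite, Finset.sum_const_zero, add_zero, Finset.sum_const, nsmul_eq_mul, mul_one,
    card_filter_dvd_Icc]

lemma sum_omegaQ_ge (q N : ℕ) :
    N * recipSum q N - N ≤ ∑ m ∈ Finset.Icc 1 N, (omegaQ m q : ℝ) := by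
  rw [Finset.sum_congr rfl fun m hm => omegaQ_eq_sum q hm, Finset.sum_comm]
  simp_rw [sum_dvd_Icc]
  have hc : ((primesOne q N).card : ℝ) ≤ N := by
    have := Finset.card_filter_le (Finset.Icc 1 N) fun p => p.Prime ∧ p % q = 1 % q
    rw [Nat.card_Icc] at this
    exact_mod_cast this
  have : ∑ p ∈ primesOne q N, ((N : ℝ) * (1 / p) - 1) ≤
      ∑ p ∈ primesOne q N, ((N / p : ℕ) : ℝ) := by
    refine Finset.sum_le_sum fun p _ => ?_
    have := Nat.lt_floor_add_one ((N : ℝ) / p)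
    rw [Nat.floor_div_eq_div] at this
    rw [mul_one_div]
    linarith
  rw [Finset.sum_sub_distrib, ← Finset.mul_sum, Finset.sum_const, nsmul_eq_mul, mul_one] at this
  unfold recipSum
  linarith

lemma sum_omegaQ_sq_le (q N : ℕ) :
    ∑ m ∈ Finset.Icc 1 N, (omegaQ m q : ℝ) ^ 2 ≤
      N * (recipSum q N) ^ 2 + N * recipSum q N := by
  have h1 : ∀ m ∈ Finset.Icc 1 N, (omegaQ m q : ℝ) ^ 2 =
      ∑ p ∈ primesOne q N, ∑ p' ∈ primesOne q N, if p ∣ m ∧ p' ∣ m then (1 : ℝ) else 0 := by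
    intro m hm
    rw [omegaQ_eq_sum q hm, sq, Finset.sum_mul_sum]
    refine Finset.sum_congr rfl fun p _ => Finset.sum_congr rfl fun p' _ => ?_
    split_ifs <;> simp_all
  rw [Finset.sum_congr rfl h1, Finset.sum_comm]
  have h2 : ∀ p ∈ primesOne q N, ∑ m ∈ Finset.Icc 1 N, ∑ p' ∈ primesOne q N,
      (if p ∣ m ∧ p' ∣ m then (1 : ℝ) else 0) ≤
      ∑ p' ∈ primesOne q N,
        ((N : ℝ) * ((1 / p) * (1 / p')) + if p' = p then N * (1 / p : ℝ) else 0) := by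
    intro p hp
    rw [Finset.sum_comm]
    refine Finset.sum_le_sum fun p' hp' => ?_
    have hpp := prime_of_mem_primesOne hp
    have hpp' := prime_of_mem_primesOne hp'
    split_ifs with h
    · subst h
      simp_rw [and_self]
      rw [sum_dvd_Icc]
      have : ((N / p' : ℕ) : ℝ) ≤ N / p' := Nat.cast_div_le
      have e : (N : ℝ) * (1 / p') = N / p' := mul_one_div _ _
      have : (0 : ℝ) ≤ (N : ℝ) * ((1 / p') * (1 / p')) := by positivity
      linarith
    · have hc : Nat.Coprime p p' := (Nat.coprime_primes hpp hpp').2 (Ne.symm h)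
      have : ∀ m, (p ∣ m ∧ p' ∣ m) ↔ p * p' ∣ m := fun m =>
        ⟨fun h => hc.mul_dvd_of_dvd_of_dvd h.1 h.2,
          fun h => ⟨(dvd_mul_right _ _).trans h, (dvd_mul_left _ _).trans h⟩⟩
      simp_rw [this]
      rw [sum_dvd_Icc]
      have h3 : ((N / (p * p') : ℕ) : ℝ) ≤ N / ((p * p' : ℕ) : ℝ) := Nat.cast_div_le
      refine h3.trans (le_of_eq ?_)
      push_cast
      rw [one_div_mul_one_div, mul_one_div, add_zero]
  refine (Finset.sum_le_sum h2).trans (le_of_eq ?_)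
  simp_rw [Finset.sum_add_distrib, Finset.sum_ite_eq', ← Finset.mul_sum]
  rw [Finset.sum_congr rfl fun p hp => if_pos hp]
  rw [← Finset.sum_mul, ← Finset.mul_sum, recipSum]
  ring

/-- The Turán–Kubilius type bound for `omegaQ · q`. -/
lemma sum_abs_omegaQ_sub_le (q N : ℕ) :
    ∑ m ∈ Finset.Icc 1 N, |(omegaQ m q : ℝ) - recipSum q N| ≤
      N * Real.sqrt (3 * recipSum q N) := by
  have hS := recipSum_nonneg q N
  have h1 : ∑ m ∈ Finset.Icc 1 N, ((omegaQ m q : ℝ) - recipSum q N) ^ 2 ≤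
      N * (3 * recipSum q N) := by
    have h2 := sum_omegaQ_sq_le q N
    have h3 := sum_omegaQ_ge q N
    have : ∑ m ∈ Finset.Icc 1 N, ((omegaQ m q : ℝ) - recipSum q N) ^ 2 =
        ∑ m ∈ Finset.Icc 1 N, (omegaQ m q : ℝ) ^ 2
          - 2 * recipSum q N * ∑ m ∈ Finset.Icc 1 N, (omegaQ m q : ℝ)
          + N * recipSum q N ^ 2 := by
      simp_rw [sub_sq]
      rw [Finset.sum_add_distrib, Finset.sum_sub_distrib, Finset.mul_sum]
      simp only [Finset.sum_const, Nat.card_Icc, nsmul_eq_mul, add_tsub_cancel_right]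
      congr 2
      exact Finset.sum_congr rfl fun m _ => by ring
    rw [this]
    nlinarith [mul_le_mul_of_nonneg_left h3 hS]
  have h2 := sq_sum_le_card_mul_sum_sq (s := Finset.Icc 1 N)
    (f := fun m => |(omegaQ m q : ℝ) - recipSum q N|)
  simp_rw [sq_abs] at h2
  rw [Nat.card_Icc, add_tsub_cancel_right] at h2
  have hN : (0 : ℝ) ≤ N := N.cast_nonneg
  refine abs_le_of_sq_le_sq' ?_ (by positivity) |>.2
  rw [mul_pow, Real.sq_sqrt (by positivity)]
  nlinarith

lemma sum_pow_omegaQ_le (q N : ℕ) {z : ℝ} (hz : 1 ≤ z) :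
    ∑ m ∈ Finset.Icc 1 N, z ^ omegaQ m q ≤ N * Real.exp ((z - 1) * recipSum q N) := by
  have h1 : ∀ m ∈ Finset.Icc 1 N, z ^ omegaQ m q =
      ∑ T ∈ (primesOne q N).powerset, (z - 1) ^ T.card * if ∏ p ∈ T, p ∣ m then 1 else 0 := by
    intro m hm
    have : z ^ omegaQ m q = ∏ p ∈ primesOne q N, (1 + (z - 1) * if p ∣ m then 1 else 0) := by
      rw [omegaQ, ← filter_dvd_primesOne q hm, ← Finset.prod_const, Finset.prod_filter]
      refine Finset.prod_congr rfl fun p _ => ?_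
      split_ifs <;> ring
    rw [this, Finset.prod_one_add]
    refine Finset.sum_congr rfl fun T hT => ?_
    rw [Finset.prod_mul_distrib, Finset.prod_const]
    congr 1
    rw [Finset.prod_ite_zero, Finset.prod_const_one]
    refine if_congr ⟨fun h => ?_, fun h p hp => (Finset.dvd_prod_of_mem _ hp).trans h⟩ rfl rfl
    refine Finset.prod_primes_dvd m (fun p hp => ?_) h
    exact (prime_of_mem_primesOne (Finset.mem_powerset.1 hT hp)).prime
  rw [Finset.sum_congr rfl h1, Finset.sum_comm]
  simp_rw [← Finset.mul_sum, sum_dvd_Icc]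
  have hz' : 0 ≤ z - 1 := by linarith
  calc ∑ T ∈ (primesOne q N).powerset, (z - 1) ^ T.card * ((N / ∏ p ∈ T, p : ℕ) : ℝ)
      ≤ ∑ T ∈ (primesOne q N).powerset, N * ∏ p ∈ T, ((z - 1) * (1 / p)) := by
        refine Finset.sum_le_sum fun T _ => ?_
        rw [Finset.prod_mul_distrib, Finset.prod_const, mul_left_comm]
        refine mul_le_mul_of_nonneg_left ?_ (by positivity)
        refine Nat.cast_div_le.trans (le_of_eq ?_)
        push_cast
        rw [Finset.prod_div_distrib, Finset.prod_const_one, mul_one_div]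
    _ = N * ∏ p ∈ primesOne q N, (1 + (z - 1) * (1 / p)) := by
        rw [Finset.prod_one_add, Finset.mul_sum]
    _ ≤ N * ∏ p ∈ primesOne q N, Real.exp ((z - 1) * (1 / p)) := by
        refine mul_le_mul_of_nonneg_left ?_ (by positivity)
        refine Finset.prod_le_prod (fun p _ => by positivity) fun p _ => ?_
        rw [add_comm]
        exact Real.add_one_le_exp _
    _ = _ := by rw [← Real.exp_sum, recipSum, Finset.mul_sum]

lemma sum_factorization_two_le (N : ℕ) :
    ∑ m ∈ Finset.Icc 1 N, (m.factorization 2 : ℝ) ≤ N := by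
  have h : ∑ m ∈ Finset.Icc 1 N, m.factorization 2 = (N.factorial).factorization 2 := by
    induction N with
    | zero => simp
    | succ n ih =>
      rw [Finset.sum_Icc_succ_top (by omega), ih, Nat.factorial_succ,
        Nat.factorization_mul (by omega) n.factorial_ne_zero, Finsupp.add_apply, add_comm]
  have h2 := sub_one_mul_padicValNat_factorial (p := 2) N
  rw [← Nat.factorization_def _ Nat.prime_two] at h2
  exact_mod_cast (by rw [h]; omega : ∑ m ∈ Finset.Icc 1 N, m.factorization 2 ≤ N)
/-- The von Mangoldt weight `Λ(n)/log n` restricted to `n ≡ 1 (mod q)`. -/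
def primeWeight (q n : ℕ) : ℝ :=
  if (n : ZMod q) = 1 then ArithmeticFunction.vonMangoldt n / Real.log n else 0

lemma primeWeight_nonneg (q n : ℕ) : 0 ≤ primeWeight q n := by
  unfold primeWeight
  split_ifs
  · exact div_nonneg ArithmeticFunction.vonMangoldt_nonneg (Real.log_natCast_nonneg n)
  · exact le_rfl

lemma vonMangoldt_div_log_le_one (n : ℕ) :
    ArithmeticFunction.vonMangoldt n / Real.log n ≤ 1 :=
  div_le_one_of_le₀ ArithmeticFunction.vonMangoldt_le_log (Real.log_natCast_nonneg n)

lemma primeWeight_le_one (q n : ℕ) : primeWeight q n ≤ 1 := by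
  unfold primeWeight
  split_ifs
  · exact vonMangoldt_div_log_le_one n
  · exact zero_le_one

/-- The Dirichlet series of `primeWeight q`. -/
def primeSeries (q : ℕ) (s : ℝ) : ℝ := ∑' n : ℕ, primeWeight q n * (n : ℝ) ^ (-s)

lemma summable_primeSeries (q : ℕ) {s : ℝ} (hs : 1 < s) :
    Summable fun n : ℕ => primeWeight q n * (n : ℝ) ^ (-s) := by
  refine Summable.of_nonneg_of_le
    (fun n => mul_nonneg (primeWeight_nonneg q n) (by positivity)) (fun n => ?_)
    (Real.summable_nat_rpow.2 (by linarith : -s < -1))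
  exact mul_le_of_le_one_left (by positivity) (primeWeight_le_one q n)

lemma one_add_mul_inv_le_rpow {s : ℝ} (hs : 1 < s) {k : ℕ} (hk : 1 ≤ k) :
    (s - 1) * ((k : ℝ) + 1) ^ (-s) ≤ (k : ℝ) ^ (1 - s) - ((k : ℝ) + 1) ^ (1 - s) := by
  have hk0 : (0 : ℝ) < k := by exact_mod_cast hk
  have hk1 : (0 : ℝ) < (k : ℝ) + 1 := by linarith
  have h1 : (k : ℝ) ^ (1 - s) = ((k : ℝ) + 1) ^ (1 - s) * ((k : ℝ) / (k + 1)) ^ (1 - s) := by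
    rw [← Real.mul_rpow hk1.le (by positivity)]
    congr 1
    field_simp
  have h2 : ((k : ℝ) + 1) ^ (-s) = ((k : ℝ) + 1) ^ (1 - s) * (1 / (k + 1)) := by
    rw [show -s = (1 - s) - 1 by ring, Real.rpow_sub_one hk1.ne']
    ring
  have h3 : 1 + (s - 1) * (1 / ((k : ℝ) + 1)) ≤ ((k : ℝ) / (k + 1)) ^ (1 - s) := by
    have hpos : (0 : ℝ) < (k : ℝ) / (k + 1) := by positivity
    rw [Real.rpow_def_of_pos hpos]
    have h4 : Real.log ((k : ℝ) / (k + 1)) ≤ (k : ℝ) / (k + 1) - 1 :=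
      Real.log_le_sub_one_of_pos hpos
    have h5 : (k : ℝ) / (k + 1) - 1 = -(1 / ((k : ℝ) + 1)) := by field_simp; ring
    have h6 := Real.add_one_le_exp (Real.log ((k : ℝ) / (k + 1)) * (1 - s))
    nlinarith
  rw [h1, h2]
  have h7 : (0 : ℝ) ≤ ((k : ℝ) + 1) ^ (1 - s) := by positivity
  nlinarith [mul_le_mul_of_nonneg_left h3 h7]

lemma sum_rpow_tail_le {s : ℝ} (hs : 1 < s) {N : ℕ} (hN : 1 ≤ N) (M : ℕ) :
    ∑ k ∈ Finset.range M, ((k + (N + 1) : ℕ) : ℝ) ^ (-s) ≤ (N : ℝ) ^ (1 - s) / (s - 1) := by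
  rw [le_div_iff₀ (by linarith), Finset.sum_mul]
  suffices h : ∑ k ∈ Finset.range M, ((k + (N + 1) : ℕ) : ℝ) ^ (-s) * (s - 1) ≤
      (N : ℝ) ^ (1 - s) - ((N + M : ℕ) : ℝ) ^ (1 - s) by
    have : (0 : ℝ) ≤ ((N + M : ℕ) : ℝ) ^ (1 - s) := by positivity
    linarith
  induction M with
  | zero => simp
  | succ M ih =>
    rw [Finset.sum_range_succ]
    have := one_add_mul_inv_le_rpow hs (k := N + M) (by omega)
    have e : ((M + (N + 1) : ℕ) : ℝ) = ((N + M : ℕ) : ℝ) + 1 := by push_cast; ring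
    have e' : ((N + (M + 1) : ℕ) : ℝ) = ((N + M : ℕ) : ℝ) + 1 := by push_cast; ring
    rw [e, e']
    linarith

lemma tsum_rpow_tail_le {s : ℝ} (hs : 1 < s) {N : ℕ} (hN : 1 ≤ N) :
    ∑' k : ℕ, ((k + (N + 1) : ℕ) : ℝ) ^ (-s) ≤ (N : ℝ) ^ (1 - s) / (s - 1) :=
  Real.tsum_le_of_sum_range_le (fun _ => by positivity) (sum_rpow_tail_le hs hN)

lemma tsum_rpow_le {s : ℝ} (hs : 1 < s) (hs2 : s ≤ 2) :
    ∑' n : ℕ, (n : ℝ) ^ (-s) ≤ 2 / (s - 1) := by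
  have hsum : Summable fun n : ℕ => (n : ℝ) ^ (-s) := Real.summable_nat_rpow.2 (by linarith)
  rw [← hsum.sum_add_tsum_nat_add 2]
  have h := tsum_rpow_tail_le hs le_rfl
  rw [Nat.cast_one, Real.one_rpow] at h
  have h0 : ∑ i ∈ Finset.range 2, (i : ℝ) ^ (-s) = 1 := by
    rw [Finset.sum_range_succ, Finset.sum_range_one, Nat.cast_zero, Nat.cast_one, Real.one_rpow,
      Real.zero_rpow (by linarith), zero_add]
  rw [h0]
  have h1 : 1 ≤ 1 / (s - 1) := by
    rw [le_div_iff₀ (by linarith)]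
    linarith
  have h2 : 2 / (s - 1) = 1 / (s - 1) + 1 / (s - 1) := by ring
  linarith

section Characters

variable {q : ℕ}

lemma LSeriesSummable_char (χ : DirichletCharacter ℂ q) {s : ℝ} (hs : 1 < s) :
    LSeriesSummable (fun n : ℕ => χ n) s :=
  LSeriesSummable_of_bounded_of_one_lt_real (fun _ _ => χ.norm_le_one _) hs

lemma norm_LSeries_char_le (χ : DirichletCharacter ℂ q) {s : ℝ} (hs : 1 < s) (hs2 : s ≤ 2) :
    ‖LSeries (fun n : ℕ => χ n) s‖ ≤ 2 / (s - 1) := by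
  have hb : ∀ n : ℕ, ‖LSeries.term (fun n : ℕ => χ n) s n‖ ≤ (n : ℝ) ^ (-s) := by
    intro n
    rcases eq_or_ne n 0 with rfl | hn
    · simp only [LSeries.term_zero, norm_zero]
      positivity
    · rw [LSeries.norm_term_eq, if_neg hn, Complex.ofReal_re, Real.rpow_neg (by positivity),
        div_eq_mul_inv]
      exact mul_le_of_le_one_left (by positivity) (χ.norm_le_one _)
  have hsum : Summable fun n : ℕ => (n : ℝ) ^ (-s) := Real.summable_nat_rpow.2 (by linarith)
  exact (tsum_of_norm_bounded hsum.hasSum hb).trans (tsum_rpow_le hs hs2)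

lemma LSeries_char_ne_zero (χ : DirichletCharacter ℂ q) {s : ℝ} (hs : 1 < s) :
    LSeries (fun n : ℕ => χ n) s ≠ 0 := by
  rw [← DirichletCharacter.LSeries_eq_exp_LSeries χ (s := (s : ℂ)) (by simpa using hs)]
  exact Complex.exp_ne_zero _

/-- Orthogonality of characters applied to `log L(s, χ)`. -/
lemma sum_log_norm_LSeries [NeZero q] {s : ℝ} (hs : 1 < s) :
    ∑ χ : DirichletCharacter ℂ q, Real.log ‖LSeries (fun n : ℕ => χ n) s‖ =
      q.totient * primeSeries q s := by
  have hs' : 1 < (s : ℂ).re := by simpa using hs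
  have hsm : ∀ χ : DirichletCharacter ℂ q, LSeriesSummable
      (fun n : ℕ => χ n * ArithmeticFunction.vonMangoldt n / Real.log n) (s : ℂ) := by
    intro χ
    refine LSeriesSummable_of_bounded_of_one_lt_real (m := 1) (fun n _ => ?_) hs
    rw [mul_div_assoc, norm_mul, ← Complex.ofReal_div, Complex.norm_real, Real.norm_eq_abs,
      abs_of_nonneg (div_nonneg ArithmeticFunction.vonMangoldt_nonneg
        (Real.log_natCast_nonneg n))]
    exact mul_le_one₀ (χ.norm_le_one _) (div_nonneg ArithmeticFunction.vonMangoldt_nonneg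
        (Real.log_natCast_nonneg n)) (vonMangoldt_div_log_le_one n)
  have h1 : ∀ χ : DirichletCharacter ℂ q, Real.log ‖LSeries (fun n : ℕ => χ n) s‖ =
      (LSeries (fun n : ℕ => χ n * ArithmeticFunction.vonMangoldt n / Real.log n) s).re := by
    intro χ
    rw [← DirichletCharacter.LSeries_eq_exp_LSeries χ hs', Complex.norm_exp, Real.log_exp]
  simp_rw [h1]
  rw [← Complex.re_sum]
  have h2 : ∑ χ : DirichletCharacter ℂ q,
      LSeries (fun n : ℕ => χ n * ArithmeticFunction.vonMangoldt n / Real.log n) s =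
      ((q.totient * primeSeries q s : ℝ) : ℂ) := by
    unfold LSeries
    rw [← Summable.tsum_finsetSum fun χ _ => hsm χ, primeSeries, ← tsum_mul_left,
      Complex.ofReal_tsum]
    refine tsum_congr fun n => ?_
    have h3 : ∀ χ : DirichletCharacter ℂ q, LSeries.term
        (fun n : ℕ => χ n * ArithmeticFunction.vonMangoldt n / Real.log n) s n =
        χ n * (ArithmeticFunction.vonMangoldt n / Real.log n * (n : ℂ) ^ (-s : ℂ)) := by
      intro χ
      rw [LSeries.term_def₀ (by simp), mul_div_assoc, mul_assoc]
    simp_rw [h3]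
    rw [← Finset.sum_mul, DirichletCharacter.sum_characters_eq, primeWeight]
    split_ifs
    · push_cast
      rw [Complex.ofReal_cpow n.cast_nonneg]
      push_cast
      ring
    · simp
  rw [h2, Complex.ofReal_re]

end Characters

section NontrivialBound

variable {q : ℕ}

lemma rpow_neg_sub_rpow_neg_le {s x r : ℝ} (hs : 1 ≤ s) (hs2 : s ≤ 2) (hx : 1 ≤ x) (hr : 0 ≤ r) :
    x ^ (-s) - (x + r) ^ (-s) ≤ 2 * r / x ^ 2 := by
  have hx0 : 0 < x := by linarith
  have hy0 : 0 < x + r := by linarith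
  have h1 : (x + r) ^ (-s) = x ^ (-s) * (1 + -(r / (x + r))) ^ s := by
    have : 1 + -(r / (x + r)) = x / (x + r) := by field_simp; ring
    rw [this, Real.div_rpow hx0.le hy0.le, Real.rpow_neg hx0.le, Real.rpow_neg hy0.le]
    field_simp
  have h2 : 1 + s * -(r / (x + r)) ≤ (1 + -(r / (x + r))) ^ s := by
    apply one_add_mul_self_le_rpow_one_add _ hs
    have : r / (x + r) ≤ 1 := by rw [div_le_one hy0]; linarith
    linarith
  have h3 : x ^ (-s) ≤ x⁻¹ := by
    rw [← Real.rpow_neg_one]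
    exact Real.rpow_le_rpow_of_exponent_le hx (by linarith)
  have h4 : 0 ≤ x ^ (-s) := by positivity
  have h5 : r / (x + r) ≤ r / x := by gcongr; linarith
  have h6 : 0 ≤ r / (x + r) := by positivity
  rw [h1]
  calc x ^ (-s) - x ^ (-s) * (1 + -(r / (x + r))) ^ s
      = x ^ (-s) * (1 - (1 + -(r / (x + r))) ^ s) := by ring
    _ ≤ x ^ (-s) * (2 * (r / x)) := by
        apply mul_le_mul_of_nonneg_left _ h4
        nlinarith
    _ ≤ x⁻¹ * (2 * (r / x)) := by gcongr
    _ = 2 * r / x ^ 2 := by field_simp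

lemma sum_range_char_eq_zero [NeZero q] {χ : DirichletCharacter ℂ q} (hχ : χ ≠ 1) :
    ∑ r ∈ Finset.range q, χ (r : ZMod q) = 0 := by
  rw [← MulChar.sum_eq_zero_of_ne_one hχ]
  refine Finset.sum_bij' (fun r _ => (r : ZMod q)) (fun a _ => a.val) (by simp)
    (fun a _ => Finset.mem_range.2 (ZMod.val_lt a)) (fun r hr => ?_) (by simp) (by simp)
  exact ZMod.val_cast_of_lt (Finset.mem_range.1 hr)

lemma norm_sum_block_le [NeZero q] {χ : DirichletCharacter ℂ q} (hχ : χ ≠ 1) {s : ℝ}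
    (hs : 1 ≤ s) (hs2 : s ≤ 2) {k : ℕ} (hk : 1 ≤ k) :
    ‖∑ r ∈ Finset.range q, χ ((k * q + r : ℕ) : ZMod q) * (((k * q + r : ℕ) : ℝ) ^ (-s) : ℝ)‖ ≤
      2 / k ^ 2 := by
  have hq : (0 : ℝ) < q := by exact_mod_cast NeZero.pos q
  have hk0 : (0 : ℝ) < k := by exact_mod_cast hk
  have hx : (1 : ℝ) ≤ (k * q : ℕ) := by exact_mod_cast Nat.mul_pos hk (NeZero.pos q)
  have h1 : ∑ r ∈ Finset.range q, χ ((k * q + r : ℕ) : ZMod q) *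
      (((k * q + r : ℕ) : ℝ) ^ (-s) : ℝ) =
      ∑ r ∈ Finset.range q, χ (r : ZMod q) *
        ((((k * q + r : ℕ) : ℝ) ^ (-s) - ((k * q : ℕ) : ℝ) ^ (-s) : ℝ) : ℂ) := by
    push_cast
    simp only [CharP.cast_eq_zero, mul_zero, zero_add, mul_sub, Finset.sum_sub_distrib,
      ← Finset.sum_mul, sum_range_char_eq_zero hχ, zero_mul, sub_zero]
  rw [h1]
  refine (norm_sum_le _ _).trans ?_
  have h2 : ∀ r ∈ Finset.range q, ‖χ (r : ZMod q) *
        ((((k * q + r : ℕ) : ℝ) ^ (-s) - ((k * q : ℕ) : ℝ) ^ (-s) : ℝ) : ℂ)‖ ≤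
        2 * q / ((k * q : ℕ) : ℝ) ^ 2 := by
    intro r hr
    rw [norm_mul, Complex.norm_real, Real.norm_eq_abs, abs_sub_comm]
    refine (mul_le_of_le_one_left (abs_nonneg _) (χ.norm_le_one _)).trans ?_
    rw [Nat.cast_add, abs_of_nonneg]
    · refine (rpow_neg_sub_rpow_neg_le hs hs2 hx r.cast_nonneg).trans ?_
      have : (r : ℝ) ≤ q := by exact_mod_cast (Finset.mem_range.1 hr).le
      gcongr
    · rw [sub_nonneg]
      exact Real.rpow_le_rpow_of_nonpos (by linarith) (by simp) (by linarith)
  refine (Finset.sum_le_sum h2).trans ?_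
  rw [Finset.sum_const, Finset.card_range, nsmul_eq_mul]
  push_cast
  apply le_of_eq
  field_simp

lemma norm_sum_range_char_le (χ : DirichletCharacter ℂ q) {s : ℝ} (hs : 1 ≤ s) (hq : 1 ≤ q) :
    ‖∑ n ∈ Finset.range q, χ (n : ZMod q) * ((n : ℝ) ^ (-s) : ℝ)‖ ≤ 1 + Real.log q := by
  refine (norm_sum_le _ _).trans ?_
  obtain ⟨q, rfl⟩ : ∃ k, q = k + 1 := ⟨q - 1, by omega⟩
  rw [Finset.sum_range_succ']
  have h0 : ((0 : ℕ) : ℝ) ^ (-s) = 0 := by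
    rw [Nat.cast_zero, Real.zero_rpow (by linarith)]
  rw [h0]
  have h1 : ∀ n ∈ Finset.range q, ‖χ ((n + 1 : ℕ) : ZMod (q + 1)) *
      (((n + 1 : ℕ) : ℝ) ^ (-s) : ℝ)‖ ≤ (((n + 1 : ℕ) : ℝ))⁻¹ := by
    intro n _
    rw [norm_mul, Complex.norm_real, Real.norm_eq_abs, abs_of_nonneg (by positivity)]
    refine (mul_le_of_le_one_left (by positivity) (χ.norm_le_one _)).trans ?_
    rw [← Real.rpow_neg_one]
    exact Real.rpow_le_rpow_of_exponent_le (by simp) (by linarith)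
  have h2 := harmonic_le_one_add_log q
  have h3 : ((harmonic q : ℚ) : ℝ) = ∑ n ∈ Finset.range q, (((n + 1 : ℕ) : ℝ))⁻¹ := by
    simp [harmonic]
  have h4 : Real.log q ≤ Real.log (q + 1 : ℕ) := by
    rcases Nat.eq_zero_or_pos q with rfl | hq
    · simp
    · exact Real.log_le_log (by exact_mod_cast hq) (by simp)
  simp only [Complex.ofReal_zero, mul_zero, norm_zero, add_zero]
  linarith [Finset.sum_le_sum h1]

lemma norm_sum_range_mul_char_le [NeZero q] {χ : DirichletCharacter ℂ q} (hχ : χ ≠ 1) {s : ℝ}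
    (hs : 1 ≤ s) (hs2 : s ≤ 2) (M : ℕ) :
    ‖∑ n ∈ Finset.range ((M + 1) * q), χ (n : ZMod q) * ((n : ℝ) ^ (-s) : ℝ)‖ ≤
      1 + Real.log q + (4 - 4 / ((M : ℝ) + 1)) := by
  induction M with
  | zero =>
    rw [zero_add, one_mul]
    have := norm_sum_range_char_le χ hs (NeZero.pos q)
    norm_num
    exact this
  | succ M ih =>
    rw [add_mul (M + 1) 1 q, one_mul, Finset.sum_range_add]
    refine (norm_add_le _ _).trans ?_
    have h := norm_sum_block_le hχ hs hs2 (k := M + 1) (by omega)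
    have h2 : 2 / ((M + 1 : ℕ) : ℝ) ^ 2 ≤ 4 / ((M : ℝ) + 1) - 4 / ((M : ℝ) + 1 + 1) := by
      push_cast
      have hM : (0 : ℝ) ≤ M := M.cast_nonneg
      rw [div_sub_div _ _ (by positivity) (by positivity), div_le_div_iff₀ (by positivity)
        (by positivity)]
      nlinarith [mul_nonneg hM hM, mul_nonneg (mul_nonneg hM hM) hM]
    push_cast at h h2 ih ⊢
    linarith

lemma norm_LSeries_char_le_log (hq : 2 ≤ q) {χ : DirichletCharacter ℂ q} (hχ : χ ≠ 1) {s : ℝ}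
    (hs : 1 < s) (hs2 : s ≤ 2) :
    ‖LSeries (fun n : ℕ => χ n) s‖ ≤ 5 + Real.log q := by
  have : NeZero q := ⟨by omega⟩
  have : Fact (1 < q) := ⟨by omega⟩
  have hterm : LSeries.term (fun n : ℕ => χ n) s =
      fun n : ℕ => χ (n : ZMod q) * ((n : ℝ) ^ (-s) : ℝ) := by
    funext n
    rw [LSeries.term_def₀ (by simpa using MulCharClass.map_nonunit χ not_isUnit_zero),
      Complex.ofReal_cpow n.cast_nonneg]
    simp
  have h := (LSeriesSummable_char χ hs).hasSum.tendsto_sum_nat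
  have h1 : Tendsto (fun M : ℕ => (M + 1) * q) atTop atTop :=
    (tendsto_add_atTop_nat 1).atTop_mul_const' (NeZero.pos q)
  have h2 := (h.comp h1).norm
  refine le_of_tendsto h2 (Eventually.of_forall fun M => ?_)
  simp only [Function.comp, hterm]
  refine (norm_sum_range_mul_char_le hχ hs.le hs2 M).trans ?_
  have : 0 ≤ 4 / ((M : ℝ) + 1) := by positivity
  linarith

end NontrivialBound

section FixedModulus

variable {q : ℕ} [NeZero q]

open DirichletCharacter in
lemma exists_abs_log_norm_LSeries_le {χ : DirichletCharacter ℂ q} (hχ : χ ≠ 1) :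
    ∃ C : ℝ, ∀ s : ℝ, 1 < s → s ≤ 2 → |Real.log ‖LSeries (fun n : ℕ => χ n) s‖| ≤ C := by
  have hc : ContinuousOn (fun s : ℝ => Real.log ‖LFunction χ s‖) (Set.Icc 1 2) := by
    refine ContinuousOn.log ?_ fun s hs => ?_
    · exact (((differentiable_LFunction hχ).continuous.comp Complex.continuous_ofReal).norm).continuousOn
    · exact norm_ne_zero_iff.2 (LFunction_ne_zero_of_one_le_re χ (.inl hχ) (by simpa using hs.1))
  obtain ⟨C, hC⟩ := isCompact_Icc.exists_bound_of_continuousOn hc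
  refine ⟨C, fun s hs hs2 => ?_⟩
  have h := hC s ⟨hs.le, hs2⟩
  rwa [LFunction_eq_LSeries χ (by simpa using hs), Real.norm_eq_abs] at h

open DirichletCharacter in
lemma exists_abs_log_norm_LSeries_one_sub_le :
    ∃ C : ℝ, ∀ s : ℝ, 1 < s → s ≤ 2 →
      |Real.log ‖LSeries (fun n : ℕ => (1 : DirichletCharacter ℂ q) n) s‖ -
        Real.log (1 / (s - 1))| ≤ C := by
  have hc : ContinuousOn (fun s : ℝ => Real.log ‖LFunctionTrivChar₁ q s‖) (Set.Icc 1 2) := by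
    refine ContinuousOn.log ?_ fun s hs => norm_ne_zero_iff.2 ?_
    · exact (((differentiable_LFunctionTrivChar₁ q).continuous.comp
        Complex.continuous_ofReal).norm).continuousOn
    · rcases eq_or_ne s 1 with rfl | h1
      · simpa using LFunctionTrivChar₁_apply_one_ne_zero q
      · have h1' : (s : ℂ) ≠ 1 := by exact_mod_cast h1
        rw [LFunctionTrivChar₁, Function.update_of_ne h1']
        exact mul_ne_zero (sub_ne_zero.2 h1')
          (LFunction_ne_zero_of_one_le_re 1 (.inr h1') (by simpa using hs.1))
  obtain ⟨C, hC⟩ := isCompact_Icc.exists_bound_of_continuousOn hc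
  refine ⟨C, fun s hs hs2 => ?_⟩
  have h := hC s ⟨hs.le, hs2⟩
  have h1' : (s : ℂ) ≠ 1 := by exact_mod_cast hs.ne'
  have hn : ‖(s : ℂ) - 1‖ = s - 1 := by
    rw [← Complex.ofReal_one, ← Complex.ofReal_sub, Complex.norm_real, Real.norm_eq_abs,
      abs_of_pos (by linarith)]
  rw [LFunctionTrivChar₁, Function.update_of_ne h1', LFunctionTrivChar,
    LFunction_eq_LSeries _ (by simpa using hs), norm_mul, Real.norm_eq_abs, hn,
    Real.log_mul (by linarith) (norm_ne_zero_iff.2 (LSeries_char_ne_zero 1 hs))] at h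
  rwa [one_div, Real.log_inv, sub_neg_eq_add, add_comm]

lemma exists_abs_primeSeries_sub_le (q : ℕ) [NeZero q] :
    ∃ C : ℝ, ∀ s : ℝ, 1 < s → s ≤ 2 →
      |primeSeries q s - Real.log (1 / (s - 1)) / q.totient| ≤ C := by
  classical
  have h : ∀ χ : DirichletCharacter ℂ q, ∃ C : ℝ, ∀ s : ℝ, 1 < s → s ≤ 2 →
      |Real.log ‖LSeries (fun n : ℕ => χ n) s‖ - if χ = 1 then Real.log (1 / (s - 1)) else 0| ≤
        C := by
    intro χ
    rcases eq_or_ne χ 1 with rfl | hχ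
    · simpa using exists_abs_log_norm_LSeries_one_sub_le (q := q)
    · simpa [hχ] using exists_abs_log_norm_LSeries_le hχ
  choose C hC using h
  have hφ : (0 : ℝ) < q.totient := by exact_mod_cast Nat.totient_pos.2 (NeZero.pos q)
  refine ⟨(∑ χ, C χ) / q.totient, fun s hs hs2 => ?_⟩
  have h1 : primeSeries q s - Real.log (1 / (s - 1)) / q.totient =
      (∑ χ : DirichletCharacter ℂ q, (Real.log ‖LSeries (fun n : ℕ => χ n) s‖ -
        if χ = 1 then Real.log (1 / (s - 1)) else 0)) / q.totient := by
    rw [Finset.sum_sub_distrib, sum_log_norm_LSeries hs]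
    simp only [Finset.sum_ite_eq', Finset.mem_univ, if_true]
    field_simp
  rw [h1, abs_div, abs_of_pos hφ]
  gcongr
  exact (Finset.abs_sum_le_sum_abs _ _).trans (Finset.sum_le_sum fun χ _ => hC χ s hs hs2)

end FixedModulus

lemma primeSeries_le {q : ℕ} (hq : 2 ≤ q) {s : ℝ} (hs : 1 < s) (hs2 : s ≤ 2) :
    primeSeries q s ≤ Real.log (2 / (s - 1)) / q.totient + Real.log (5 + Real.log q) := by
  classical
  have : NeZero q := ⟨by omega⟩
  have hφ : (0 : ℝ) < q.totient := by exact_mod_cast Nat.totient_pos.2 (NeZero.pos q)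
  have hlq : 0 ≤ Real.log q := Real.log_natCast_nonneg q
  have hl5 : 0 ≤ Real.log (5 + Real.log q) := Real.log_nonneg (by linarith)
  rw [div_add' _ _ _ hφ.ne', le_div_iff₀ hφ, mul_comm, ← sum_log_norm_LSeries hs]
  have hb : ∀ χ : DirichletCharacter ℂ q, Real.log ‖LSeries (fun n : ℕ => χ n) s‖ ≤
      (if χ = 1 then Real.log (2 / (s - 1)) else 0) + Real.log (5 + Real.log q) := by
    intro χ
    have hpos : 0 < ‖LSeries (fun n : ℕ => χ n) s‖ := norm_pos_iff.2 (LSeries_char_ne_zero χ hs)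
    split_ifs with h
    · exact (Real.log_le_log hpos (norm_LSeries_char_le χ hs hs2)).trans (by linarith)
    · rw [zero_add]
      exact Real.log_le_log hpos (norm_LSeries_char_le_log hq h hs hs2)
  refine (Finset.sum_le_sum fun χ _ => hb χ).trans ?_
  have hcard : (Fintype.card (DirichletCharacter ℂ q) : ℝ) = q.totient := by
    rw [← Nat.card_eq_fintype_card,
      DirichletCharacter.card_eq_totient_of_hasEnoughRootsOfUnity ℂ q]
  rw [Finset.sum_add_distrib, Finset.sum_const, Finset.card_univ, nsmul_eq_mul, hcard]
  simp [mul_comm]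

section LogLog

lemma one_lt_log_three : 1 < Real.log 3 := by
  rw [Real.lt_log_iff_exp_lt (by norm_num)]
  linarith [Real.exp_one_lt_d9]

lemma one_lt_log {N : ℕ} (hN : 3 ≤ N) : 1 < Real.log N :=
  one_lt_log_three.trans_le (Real.log_le_log (by norm_num) (by exact_mod_cast hN))

lemma LL_three_pos : 0 < LL 3 := by
  unfold LL
  exact Real.log_pos (by exact_mod_cast one_lt_log_three)

lemma LL_three_le {N : ℕ} (hN : 3 ≤ N) : LL 3 ≤ LL N := by
  unfold LL
  refine Real.log_le_log (by push_cast; linarith [one_lt_log_three]) ?_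
  exact Real.log_le_log (by norm_num) (by exact_mod_cast hN)

lemma LL_pos {N : ℕ} (hN : 3 ≤ N) : 0 < LL N := LL_three_pos.trans_le (LL_three_le hN)

lemma one_le_sqrt_LL {N : ℕ} (hN : 3 ≤ N) :
    1 ≤ (Real.sqrt (LL 3))⁻¹ * Real.sqrt (LL N) := by
  rw [inv_mul_eq_div, le_div_iff₀ (Real.sqrt_pos.2 LL_three_pos), one_mul]
  exact Real.sqrt_le_sqrt (LL_three_le hN)

end LogLog

section Mertens

open ArithmeticFunction

lemma sum_vonMangoldt_div_le (N : ℕ) (hN : 1 ≤ N) :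
    ∑ n ∈ Finset.Icc 1 N, vonMangoldt n / n ≤ Real.log N + 6 := by
  have hN0 : (0 : ℝ) < N := by exact_mod_cast hN
  have h1 : ∑ n ∈ Finset.Icc 1 N, vonMangoldt n * ((N / n : ℕ) : ℝ) =
      ∑ n ∈ Finset.Icc 1 N, Real.log n := by
    have := sum_Ioc_mul_zeta_eq_sum vonMangoldt N
    rw [vonMangoldt_mul_zeta] at this
    exact this.symm
  have h2 : ∑ n ∈ Finset.Icc 1 N, Real.log n ≤ N * Real.log N := by
    have : ∀ n ∈ Finset.Icc 1 N, Real.log n ≤ Real.log N := by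
      intro n hn
      obtain ⟨h, h'⟩ := Finset.mem_Icc.1 hn
      exact Real.log_le_log (by exact_mod_cast h) (by exact_mod_cast h')
    simpa using Finset.sum_le_sum this
  have h3 : ∑ n ∈ Finset.Icc 1 N, vonMangoldt n ≤ 6 * N := by
    have h := Chebyshev.psi_le_const_mul_self hN0.le
    have h4 : Real.log 4 ≤ 2 := by
      rw [show (4 : ℝ) = 2 ^ 2 by norm_num, Real.log_pow]
      push_cast
      linarith [Real.log_two_lt_d9]
    have h5 : ∑ n ∈ Finset.Icc 1 N, vonMangoldt n = Chebyshev.psi N := by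
      rw [Chebyshev.psi, Nat.floor_natCast]
      rfl
    rw [h5]
    nlinarith
  have h4 : N * ∑ n ∈ Finset.Icc 1 N, vonMangoldt n / n ≤
      ∑ n ∈ Finset.Icc 1 N, (vonMangoldt n * ((N / n : ℕ) : ℝ) + vonMangoldt n) := by
    rw [Finset.mul_sum]
    refine Finset.sum_le_sum fun n hn => ?_
    have h6 : (N : ℝ) / n ≤ ((N / n : ℕ) : ℝ) + 1 := by
      rw [← Nat.floor_div_eq_div (K := ℝ)]
      exact (Nat.lt_floor_add_one _).le
    calc (N : ℝ) * (vonMangoldt n / n) = vonMangoldt n * (N / n) := by ring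
      _ ≤ vonMangoldt n * (((N / n : ℕ) : ℝ) + 1) :=
        mul_le_mul_of_nonneg_left h6 vonMangoldt_nonneg
      _ = _ := by ring
  rw [Finset.sum_add_distrib, h1] at h4
  refine le_of_mul_le_mul_left ?_ hN0
  linarith

end Mertens

section RecipSum

lemma primeWeight_eq_one {q N p : ℕ} (h : p ∈ primesOne q N) : primeWeight q p = 1 := by
  have hp := prime_of_mem_primesOne h
  have hmod : (p : ZMod q) = 1 := by
    have := (ZMod.natCast_eq_natCast_iff' p 1 q).2 (Finset.mem_filter.1 h).2.2
    simpa using this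
  rw [primeWeight, if_pos hmod, ArithmeticFunction.vonMangoldt_apply_prime hp, div_self]
  exact (Real.log_pos (by exact_mod_cast hp.one_lt)).ne'

lemma recipSum_le_primeSeries (q : ℕ) {N : ℕ} (hN : 3 ≤ N) :
    recipSum q N ≤ primeSeries q (1 + 1 / Real.log N) + 7 := by
  have hL := one_lt_log hN
  set δ : ℝ := 1 / Real.log N with hδ
  have hδ0 : 0 < δ := by positivity
  have h1 : ∀ p ∈ primesOne q N, (1 / p : ℝ) ≤
      primeWeight q p * (p : ℝ) ^ (-(1 + δ)) + δ * (ArithmeticFunction.vonMangoldt p / p) := by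
    intro p hp
    have hpp := prime_of_mem_primesOne hp
    have hp0 : (0 : ℝ) < p := by exact_mod_cast hpp.pos
    rw [primeWeight_eq_one hp, one_mul, ArithmeticFunction.vonMangoldt_apply_prime hpp,
      neg_add, Real.rpow_add hp0, Real.rpow_neg_one, Real.rpow_def_of_pos hp0]
    have := Real.add_one_le_exp (Real.log p * -δ)
    have h2 : (p : ℝ)⁻¹ * (Real.log p * -δ + 1) ≤ (p : ℝ)⁻¹ * Real.exp (Real.log p * -δ) := by
      gcongr
    calc (1 / p : ℝ) = (p : ℝ)⁻¹ * (Real.log p * -δ + 1) + δ * (Real.log p / p) := by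
          field_simp; ring
      _ ≤ _ := by gcongr
  have h2 : ∑ p ∈ primesOne q N, primeWeight q p * (p : ℝ) ^ (-(1 + δ)) ≤
      primeSeries q (1 + δ) :=
    (summable_primeSeries q (by linarith)).sum_le_tsum _ fun n _ =>
      mul_nonneg (primeWeight_nonneg q n) (by positivity)
  have h3 : ∑ p ∈ primesOne q N, ArithmeticFunction.vonMangoldt p / p ≤ Real.log N + 6 := by
    refine le_trans ?_ (sum_vonMangoldt_div_le N (by omega))
    exact Finset.sum_le_sum_of_subset_of_nonneg (Finset.filter_subset _ _) fun n _ _ =>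
      div_nonneg ArithmeticFunction.vonMangoldt_nonneg n.cast_nonneg
  have h4 := Finset.sum_le_sum h1
  rw [Finset.sum_add_distrib, ← Finset.mul_sum] at h4
  have h5 : δ * ∑ p ∈ primesOne q N, ArithmeticFunction.vonMangoldt p / p ≤ 7 := by
    calc _ ≤ δ * (Real.log N + 6) := by gcongr
      _ = 1 + 6 * δ := by rw [hδ]; field_simp
      _ ≤ 7 := by
        have : δ ≤ 1 := by rw [hδ, div_le_one (by linarith)]; exact hL.le
        linarith
  unfold recipSum
  linarith

lemma exists_primeSeries_le_recipSum (q : ℕ) [NeZero q] :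
    ∃ K : ℝ, ∀ (N : ℕ) (s : ℝ), 1 ≤ N → 1 < s →
      primeSeries q s ≤ recipSum q N + K + (N : ℝ) ^ (1 - s) / (s - 1) := by
  have hK := (ArithmeticFunction.vonMangoldt.summable_residueClass_non_primes_div
    (1 : ZMod q)).div_const (Real.log 2)
  set g : ℕ → ℝ := fun n => (if n.Prime then 0 else
    ArithmeticFunction.vonMangoldt.residueClass (1 : ZMod q) n) / n / Real.log 2 with hg
  have hg0 : ∀ n, 0 ≤ g n := by
    intro n
    simp only [hg]
    have : 0 ≤ Real.log 2 := Real.log_nonneg (by norm_num)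
    split_ifs
    · simp
    · have := ArithmeticFunction.vonMangoldt.residueClass_nonneg (1 : ZMod q) n
      positivity
  refine ⟨∑' n, g n, fun N s hN hs => ?_⟩
  have hsum := summable_primeSeries q hs
  rw [primeSeries, ← hsum.sum_add_tsum_nat_add (N + 1)]
  have htail : ∑' n : ℕ, primeWeight q (n + (N + 1)) * ((n + (N + 1) : ℕ) : ℝ) ^ (-s) ≤
      (N : ℝ) ^ (1 - s) / (s - 1) := by
    refine (Summable.tsum_le_tsum (fun n => ?_) ((summable_nat_add_iff (N + 1)).2 hsum)
      ((summable_nat_add_iff (N + 1)).2 (Real.summable_nat_rpow.2 (by linarith : -s < -1)))).trans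
      (tsum_rpow_tail_le hs hN)
    exact mul_le_of_le_one_left (by positivity) (primeWeight_le_one q _)
  have hhead : ∀ n ∈ Finset.range (N + 1), primeWeight q n * (n : ℝ) ^ (-s) ≤
      (if n ∈ primesOne q N then (1 / n : ℝ) else 0) + g n := by
    intro n hn
    rcases Nat.lt_or_ge n 2 with h2 | h2
    · have : primeWeight q n = 0 := by
        unfold primeWeight
        interval_cases n <;> simp
      rw [this, zero_mul]
      exact add_nonneg (by positivity) (hg0 n)
    · have hn0 : (0 : ℝ) < n := by positivity
      have hn2 : (2 : ℝ) ≤ n := by exact_mod_cast h2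
      have hpw : (n : ℝ) ^ (-s) ≤ (n : ℝ)⁻¹ := by
        rw [← Real.rpow_neg_one]
        exact Real.rpow_le_rpow_of_exponent_le (by linarith) (by linarith)
      have h3 : primeWeight q n * (n : ℝ) ^ (-s) ≤ primeWeight q n * (n : ℝ)⁻¹ :=
        mul_le_mul_of_nonneg_left hpw (primeWeight_nonneg q n)
      refine h3.trans ?_
      by_cases hmod : (n : ZMod q) = 1
      · by_cases hp : n.Prime
        · have hmem : n ∈ primesOne q N := by
            refine Finset.mem_filter.2 ⟨Finset.mem_Icc.2 ⟨by omega, ?_⟩, hp, ?_⟩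
            · exact Nat.lt_succ_iff.1 (Finset.mem_range.1 hn)
            · exact (ZMod.natCast_eq_natCast_iff' n 1 q).1 (by simpa using hmod)
          rw [primeWeight_eq_one hmem, if_pos hmem, one_mul, one_div]
          linarith [hg0 n]
        · have hnm : n ∉ primesOne q N := fun h => hp (prime_of_mem_primesOne h)
          rw [if_neg hnm, zero_add]
          simp only [hg, if_neg hp, primeWeight, if_pos hmod,
            ArithmeticFunction.vonMangoldt.residueClass]
          rw [Set.indicator_of_mem (by simpa using hmod), ← div_eq_mul_inv, div_right_comm]
          have hl2 : 0 < Real.log 2 := Real.log_pos (by norm_num)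
          have hll : Real.log 2 ≤ Real.log n := Real.log_le_log (by norm_num) hn2
          have hv := ArithmeticFunction.vonMangoldt_nonneg (n := n)
          gcongr
      · rw [primeWeight, if_neg hmod, zero_mul]
        exact add_nonneg (by positivity) (hg0 n)
  have h4 := Finset.sum_le_sum hhead
  rw [Finset.sum_add_distrib] at h4
  have h5 : ∑ n ∈ Finset.range (N + 1), (if n ∈ primesOne q N then (1 / n : ℝ) else 0) =
      recipSum q N := by
    rw [← Finset.sum_filter, recipSum]
    congr 1
    ext n
    simp only [Finset.mem_filter, Finset.mem_range, and_iff_right_iff_imp]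
    intro h
    have := (Finset.mem_Icc.1 (Finset.mem_filter.1 h).1).2
    omega
  have h6 : ∑ n ∈ Finset.range (N + 1), g n ≤ ∑' n, g n := hK.sum_le_tsum _ fun n _ => hg0 n
  linarith

lemma two_mul_log_le {x : ℝ} (hx : 0 < x) : 2 * Real.log x ≤ x := by
  have h := Real.log_le_sub_one_of_pos (by positivity : 0 < x / 2)
  rw [Real.log_div hx.ne' (by norm_num)] at h
  linarith [Real.log_two_lt_d9]

lemma exists_abs_recipSum_sub_le (q : ℕ) [NeZero q] :
    ∃ C : ℝ, ∀ N : ℕ, 3 ≤ N →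
      |recipSum q N - LL N / q.totient| ≤ C * Real.sqrt (LL N) := by
  obtain ⟨C, hC⟩ := exists_abs_primeSeries_sub_le q
  obtain ⟨K, hK⟩ := exists_primeSeries_le_recipSum q
  have hφ : (1 : ℝ) ≤ q.totient := by exact_mod_cast Nat.totient_pos.2 (NeZero.pos q)
  refine ⟨(|C| + |K| + 7 + 1 / (2 * LL 3)) * (Real.sqrt (LL 3))⁻¹ + 4, fun N hN => ?_⟩
  have hl := one_lt_log hN
  have hLL := LL_pos hN
  have hc3 := LL_three_pos
  have hN0 : (0 : ℝ) < N := by positivity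
  have hone := one_le_sqrt_LL hN
  set B := |C| + |K| + 7 + 1 / (2 * LL 3) with hB
  have hB0 : 0 ≤ B := by positivity
  have hmain : B ≤ B * (Real.sqrt (LL 3))⁻¹ * Real.sqrt (LL N) := by
    rw [mul_assoc]
    exact le_mul_of_one_le_right hB0 hone
  have hs0 := Real.sqrt_nonneg (LL N)
  have hCle := le_abs_self C
  have hKle := le_abs_self K
  have hC0 := abs_nonneg C
  have hK0 := abs_nonneg K
  have hc30 : 0 ≤ 1 / (2 * LL 3) := by positivity
  rw [abs_le]
  constructor
  · set δ : ℝ := 2 * LL N / Real.log N with hδ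
    have hδ0 : 0 < δ := by positivity
    have hδ1 : δ ≤ 1 := by
      rw [hδ, div_le_one (by linarith)]
      exact two_mul_log_le (by linarith)
    have h1 := (abs_le.1 (hC (1 + δ) (by linarith) (by linarith))).1
    have h2 := hK N (1 + δ) (by omega) (by linarith)
    have h3 : (N : ℝ) ^ (1 - (1 + δ)) / (1 + δ - 1) ≤ 1 / (2 * LL 3) := by
      have e1 : (N : ℝ) ^ (1 - (1 + δ)) = (Real.log N)⁻¹ ^ 2 := by
        rw [Real.rpow_def_of_pos hN0, ← Real.exp_log (by positivity : 0 < (Real.log N)⁻¹ ^ 2)]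
        congr 1
        rw [Real.log_pow, Real.log_inv, hδ, LL]
        push_cast
        field_simp
        ring
      rw [e1, hδ]
      have e2 : (Real.log N)⁻¹ ^ 2 / (1 + 2 * LL N / Real.log N - 1) =
          1 / (2 * (LL N * Real.log N)) := by
        rw [add_sub_cancel_left]
        field_simp
      rw [e2]
      gcongr
      nlinarith [LL_three_le hN]
    have h4 : Real.log (1 / (1 + δ - 1)) = LL N - Real.log (2 * LL N) := by
      rw [add_sub_cancel_left, hδ, one_div_div, Real.log_div (by linarith) (by linarith), LL]
    have h5 : Real.log (2 * LL N) ≤ 4 * Real.sqrt (LL N) := by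
      have e := two_mul_log_le (Real.sqrt_pos.2 (by linarith : 0 < 2 * LL N))
      rw [Real.log_sqrt (by linarith)] at e
      have e2 : Real.sqrt (2 * LL N) ≤ 4 * Real.sqrt (LL N) := by
        rw [show 4 * Real.sqrt (LL N) = Real.sqrt (16 * LL N) by
          rw [Real.sqrt_mul (by norm_num), show (16 : ℝ) = 4 ^ 2 by norm_num,
            Real.sqrt_sq (by norm_num)]]
        exact Real.sqrt_le_sqrt (by linarith)
      linarith
    have h6 : Real.log (2 * LL N) / q.totient ≤ 4 * Real.sqrt (LL N) := by
      refine (div_le_div_of_nonneg_right h5 (by linarith)).trans ?_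
      exact div_le_self (by linarith) hφ
    rw [h4, sub_div] at h1
    linarith
  · have hδ1 : 1 / Real.log N ≤ 1 := by rw [div_le_one (by linarith)]; exact hl.le
    have hδ0 : 0 < 1 / Real.log N := by positivity
    have h1 := (abs_le.1 (hC (1 + 1 / Real.log N) (by linarith) (by linarith))).2
    rw [add_sub_cancel_left, one_div_one_div, ← LL] at h1
    have h2 := recipSum_le_primeSeries q hN
    linarith

lemma recipSum_le {q : ℕ} (hq : 2 ≤ q) {N : ℕ} (hN : 3 ≤ N) :
    recipSum q N ≤ LL N / q.totient + Real.log (5 + Real.log q) + 8 := by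
  have hl := one_lt_log hN
  have hφ : (1 : ℝ) ≤ q.totient := by exact_mod_cast Nat.totient_pos.2 (by omega)
  have hδ1 : 1 / Real.log N ≤ 1 := by rw [div_le_one (by linarith)]; exact hl.le
  have hδ0 : 0 < 1 / Real.log N := by positivity
  have h1 := primeSeries_le hq (s := 1 + 1 / Real.log N) (by linarith) (by linarith)
  have h2 := recipSum_le_primeSeries q hN
  have h3 : Real.log (2 / (1 + 1 / Real.log N - 1)) = Real.log 2 + LL N := by
    rw [add_sub_cancel_left, div_div_eq_mul_div, div_one,
      Real.log_mul (by norm_num) (by linarith), LL]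
  have h4 : Real.log 2 / q.totient ≤ 1 :=
    (div_le_self (Real.log_nonneg (by norm_num)) hφ).trans (by linarith [Real.log_two_lt_d9])
  rw [h3, add_div] at h1
  linarith

lemma recipSum_le_div {q : ℕ} (hq : 2 ≤ q) (N : ℕ) :
    recipSum q N ≤ (1 + Real.log N) / q := by
  have h1 : ∀ p ∈ primesOne q N, p / q ∈ Finset.Icc 1 N ∧ p = p / q * q + 1 := by
    intro p hp
    have hpp := prime_of_mem_primesOne hp
    obtain ⟨h1, -, h2⟩ := Finset.mem_filter.1 hp
    rw [Nat.mod_eq_of_lt (by omega : 1 < q)] at h2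
    have h3 := Nat.div_add_mod p q
    rw [h2, mul_comm] at h3
    have h4 : p / q ≠ 0 := by
      intro h
      rw [h, zero_mul, zero_add] at h3
      exact hpp.one_lt.ne h3
    refine ⟨Finset.mem_Icc.2 ⟨Nat.one_le_iff_ne_zero.2 h4, ?_⟩, h3.symm⟩
    exact (Nat.div_le_self p q).trans (Finset.mem_Icc.1 h1).2
  have hq0 : (0 : ℝ) < q := by positivity
  have h2 : recipSum q N ≤ ∑ p ∈ primesOne q N, (((p / q : ℕ) : ℝ))⁻¹ / q := by
    refine Finset.sum_le_sum fun p hp => ?_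
    obtain ⟨h3, h4⟩ := h1 p hp
    have h5 : (0 : ℝ) < (p / q : ℕ) := by exact_mod_cast (Finset.mem_Icc.1 h3).1
    have h6 : (p : ℝ) = (p / q : ℕ) * q + 1 := by exact_mod_cast h4
    rw [show (((p / q : ℕ) : ℝ))⁻¹ / q = 1 / ((p / q : ℕ) * q) by field_simp]
    gcongr
    linarith
  have h3 : ∑ p ∈ primesOne q N, (((p / q : ℕ) : ℝ))⁻¹ / q ≤
      ∑ k ∈ Finset.Icc 1 N, ((k : ℝ))⁻¹ / q := by
    rw [← Finset.sum_image (g := fun p => p / q) (f := fun k : ℕ => ((k : ℝ))⁻¹ / q)]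
    · refine Finset.sum_le_sum_of_subset_of_nonneg ?_ fun k _ _ => by positivity
      intro k hk
      obtain ⟨p, hp, rfl⟩ := Finset.mem_image.1 hk
      exact (h1 p hp).1
    · intro p hp p' hp' h
      rw [(h1 p hp).2, (h1 p' hp').2]
      simp only at h
      rw [h]
  have h4 : ∑ k ∈ Finset.Icc 1 N, ((k : ℝ))⁻¹ ≤ 1 + Real.log N := by
    have := harmonic_le_one_add_log N
    rw [harmonic_eq_sum_Icc] at this
    push_cast at this
    exact this
  refine (h2.trans h3).trans ?_
  rw [← Finset.sum_div]
  gcongr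

end RecipSum

section InvariantFactors

/-- `ℤ/a × ℤ/b ≅ ℤ/gcd(a,b) × ℤ/lcm(a,b)`. -/
lemma nonempty_zmod_prod_addEquiv_gcd_lcm {a b : ℕ} (ha : 0 < a) (hb : 0 < b) :
    Nonempty (ZMod a × ZMod b ≃+ ZMod (a.gcd b) × ZMod (a.lcm b)) := by
  set g := a.gcd b with hg
  set l := a.lcm b with hl
  have hg0 : 0 < g := Nat.gcd_pos_of_pos_left _ ha
  have hl0 : 0 < l := Nat.lcm_pos ha hb
  obtain ⟨a₁, ha₁⟩ := Nat.gcd_dvd_left a b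
  obtain ⟨b₁, hb₁⟩ := Nat.gcd_dvd_right a b
  rw [← hg] at ha₁ hb₁
  have hgl : g * l = a * b := Nat.gcd_mul_lcm a b
  have hlb : l = b₁ * a := by
    have : g * l = g * (b₁ * a) := by rw [hgl, ← mul_assoc, ← hb₁, mul_comm]
    exact Nat.eq_of_mul_eq_mul_left hg0 this
  have hla : l = a₁ * b := by
    have : g * l = g * (a₁ * b) := by rw [hgl, ← mul_assoc, ← ha₁]
    exact Nat.eq_of_mul_eq_mul_left hg0 this
  set r := a.gcdA b
  set s := a.gcdB b
  have hbez : (g : ℤ) = a * r + b * s := Nat.gcd_eq_gcd_ab a b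
  have hbez1 : (a₁ : ℤ) * r + b₁ * s = 1 := by
    have hg0' : (g : ℤ) ≠ 0 := by exact_mod_cast hg0.ne'
    apply mul_left_cancel₀ hg0'
    have e1 : (a : ℤ) = g * a₁ := by exact_mod_cast ha₁
    have e2 : (b : ℤ) = g * b₁ := by exact_mod_cast hb₁
    rw [e1, e2] at hbez
    linear_combination -hbez
  let f₁ : ZMod a →+ ZMod g × ZMod l := ZMod.lift a
    ⟨zmultiplesHom (ZMod g × ZMod l) (1, ((s * b₁ : ℤ) : ZMod l)), by
      rw [zmultiplesHom_apply, Prod.ext_iff]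
      constructor
      · simpa using (ZMod.natCast_eq_zero_iff a g).2 (Nat.gcd_dvd_left a b)
      · have : ((b₁ : ZMod l) * a) = 0 := by
          rw [← Nat.cast_mul, ← hlb, ZMod.natCast_self]
        simp only [natCast_zsmul, nsmul_eq_mul, Prod.snd_mul, Prod.snd_natCast, Prod.snd_zero]
        push_cast
        linear_combination (s : ZMod l) * this⟩
  let f₂ : ZMod b →+ ZMod g × ZMod l := ZMod.lift b
    ⟨zmultiplesHom (ZMod g × ZMod l) (-1, ((r * a₁ : ℤ) : ZMod l)), by
      rw [zmultiplesHom_apply, Prod.ext_iff]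
      constructor
      · simpa using (ZMod.natCast_eq_zero_iff b g).2 (Nat.gcd_dvd_right a b)
      · have : ((a₁ : ZMod l) * b) = 0 := by
          rw [← Nat.cast_mul, ← hla, ZMod.natCast_self]
        simp only [natCast_zsmul, nsmul_eq_mul, Prod.snd_mul, Prod.snd_natCast, Prod.snd_zero]
        push_cast
        linear_combination (r : ZMod l) * this⟩
  let f : ZMod a × ZMod b →+ ZMod g × ZMod l := f₁.coprod f₂
  have hinj : Function.Injective f := by
    rw [injective_iff_map_eq_zero]
    rintro ⟨x, y⟩ hxy
    obtain ⟨x, rfl⟩ := ZMod.intCast_surjective x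
    obtain ⟨y, rfl⟩ := ZMod.intCast_surjective y
    simp only [f, f₁, f₂, AddMonoidHom.coprod_apply, ZMod.lift_coe, zmultiplesHom_apply,
      Prod.ext_iff, Prod.fst_add, Prod.snd_add, Prod.fst_mul, Prod.snd_mul, Prod.fst_intCast,
      Prod.snd_intCast, Prod.fst_zero, Prod.snd_zero, zsmul_eq_mul] at hxy
    obtain ⟨h1, h2⟩ := hxy
    have h1' : ((x - y : ℤ) : ZMod g) = 0 := by push_cast; linear_combination h1
    have h2' : ((x * (s * b₁) + y * (r * a₁) : ℤ) : ZMod l) = 0 := by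
      push_cast at h2 ⊢; linear_combination h2
    rw [ZMod.intCast_zmod_eq_zero_iff_dvd] at h1' h2'
    obtain ⟨k, hk⟩ := h1'
    obtain ⟨t, ht⟩ := h2'
    have e1 : (a : ℤ) = g * a₁ := by exact_mod_cast ha₁
    have e2 : (b : ℤ) = g * b₁ := by exact_mod_cast hb₁
    have e3 : (l : ℤ) = b₁ * a := by exact_mod_cast hlb
    have e4 : (l : ℤ) = a₁ * b := by exact_mod_cast hla
    rw [Prod.ext_iff]
    constructor
    · change ((x : ℤ) : ZMod a) = 0
      rw [ZMod.intCast_zmod_eq_zero_iff_dvd]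
      refine ⟨b₁ * t + r * k, ?_⟩
      linear_combination ht + e3 * t - r * k * e1 - x * hbez1 + r * a₁ * hk
    · change ((y : ℤ) : ZMod b) = 0
      rw [ZMod.intCast_zmod_eq_zero_iff_dvd]
      refine ⟨a₁ * t - s * k, ?_⟩
      linear_combination ht + e4 * t + s * k * e2 - y * hbez1 - s * b₁ * hk
  have : NeZero a := ⟨ha.ne'⟩
  have : NeZero b := ⟨hb.ne'⟩
  have : NeZero g := ⟨hg0.ne'⟩
  have : NeZero l := ⟨hl0.ne'⟩
  refine ⟨AddEquiv.ofBijective f ((Fintype.bijective_iff_injective_and_card f).2 ⟨hinj, ?_⟩)⟩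
  rw [Fintype.card_prod, Fintype.card_prod, ZMod.card, ZMod.card, ZMod.card, ZMod.card, hgl]

/-- A sequence of integers greater than `1`, each divisible by the following ones. -/
def IsDivChain {K : ℕ} (lam : Fin K → ℕ) : Prop :=
  (∀ j, 1 < lam j) ∧ ∀ j k, j ≤ k → lam k ∣ lam j

/-- Splitting off the first coordinate of a finite product. -/
def piFinSuccAddEquiv {K : ℕ} (lam : Fin (K + 1) → ℕ) :
    (ZMod (lam 0) × ∀ j : Fin K, ZMod (lam j.succ)) ≃+ ∀ j, ZMod (lam j) where
  toEquiv := Fin.consEquiv fun j => ZMod (lam j)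
  map_add' x y := by
    funext j
    refine Fin.cases ?_ (fun j => ?_) j <;> rfl

lemma IsDivChain.cons {K L : ℕ} {lam : Fin K → ℕ} (h : IsDivChain lam) (hL : 1 < L)
    (hdvd : ∀ j, lam j ∣ L) : IsDivChain (Fin.cons L lam : Fin (K + 1) → ℕ) := by
  constructor
  · intro j
    refine Fin.cases ?_ (fun j => ?_) j
    · simpa using hL
    · simpa using h.1 j
  · intro j k
    refine Fin.cases ?_ (fun k => ?_) k
    · intro hj
      obtain rfl : j = 0 := Fin.le_zero_iff.1 hj
      exact dvd_rfl
    · refine Fin.cases ?_ (fun j => ?_) j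
      · intro _
        simpa using hdvd k
      · intro hj
        simpa using h.2 j k (Fin.succ_le_succ_iff.1 hj)

lemma IsDivChain.exists_insert {n K : ℕ} (hn : 0 < n) {lam : Fin K → ℕ} (h : IsDivChain lam) :
    ∃ (K' : ℕ) (lam' : Fin K' → ℕ), IsDivChain lam' ∧
      Nonempty (ZMod n × (∀ j, ZMod (lam j)) ≃+ ∀ j, ZMod (lam' j)) ∧
      ∀ M, n ∣ M → (∀ j, lam j ∣ M) → ∀ j, lam' j ∣ M := by
  induction K generalizing n with
  | zero =>
    rcases (Nat.succ_le_of_lt hn).eq_or_lt with rfl | hn1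
    · refine ⟨0, lam, h, ⟨AddEquiv.uniqueProd⟩, fun M _ h2 => h2⟩
    · refine ⟨1, Fin.cons n lam, h.cons hn1 fun j => j.elim0,
        ⟨piFinSuccAddEquiv (Fin.cons n lam : Fin 1 → ℕ)⟩, fun M h1 _ j => ?_⟩
      obtain rfl : j = 0 := Subsingleton.elim _ _
      simpa using h1
  | succ K ih =>
    have hl0 : 0 < lam 0 := by have := h.1 0; omega
    have htail : IsDivChain fun j : Fin K => lam j.succ :=
      ⟨fun j => h.1 _, fun j k hjk => h.2 _ _ (Fin.succ_le_succ_iff.2 hjk)⟩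
    obtain ⟨K', lam', h1, ⟨e⟩, h2⟩ := ih (Nat.gcd_pos_of_pos_left (lam 0) hn) htail
    have hL : 1 < n.lcm (lam 0) :=
      (h.1 0).trans_le (Nat.le_of_dvd (Nat.lcm_pos hn hl0) (Nat.dvd_lcm_right _ _))
    obtain ⟨e₀⟩ := nonempty_zmod_prod_addEquiv_gcd_lcm hn hl0
    refine ⟨K' + 1, Fin.cons (n.lcm (lam 0)) lam', h1.cons hL fun j => ?_, ⟨?_⟩, ?_⟩
    · refine h2 _ ?_ (fun j => ?_) j
      · exact (Nat.gcd_dvd_left _ _).trans (Nat.dvd_lcm_left _ _)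
      · exact (h.2 0 j.succ (Fin.zero_le _)).trans (Nat.dvd_lcm_right _ _)
    · refine AddEquiv.trans ?_ (piFinSuccAddEquiv (Fin.cons (n.lcm (lam 0)) lam'))
      refine (AddEquiv.prodCongr (AddEquiv.refl _) (piFinSuccAddEquiv lam).symm).trans ?_
      refine AddEquiv.prodAssoc.symm.trans ?_
      refine (AddEquiv.prodCongr (e₀.trans AddEquiv.prodComm) (AddEquiv.refl _)).trans ?_
      exact AddEquiv.prodAssoc.trans (AddEquiv.prodCongr (AddEquiv.refl _) e)
    · intro M hnM hlM j
      refine Fin.cases ?_ (fun j => ?_) j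
      · simpa using Nat.lcm_dvd hnM (hlM 0)
      · simpa using h2 M ((Nat.gcd_dvd_left _ _).trans hnM) (fun j => hlM _) j

lemma exists_isDivChain_addEquiv {k : ℕ} (n : Fin k → ℕ) (hn : ∀ i, 0 < n i) :
    ∃ (K : ℕ) (lam : Fin K → ℕ), IsDivChain lam ∧
      Nonempty ((∀ i, ZMod (n i)) ≃+ ∀ j, ZMod (lam j)) := by
  induction k with
  | zero => exact ⟨0, n, ⟨fun j => j.elim0, fun j => j.elim0⟩, ⟨AddEquiv.refl _⟩⟩
  | succ k ih =>
    obtain ⟨K, lam, h, ⟨e⟩⟩ := ih (fun i => n i.succ) fun i => hn _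
    obtain ⟨K', lam', h', ⟨e'⟩, -⟩ := h.exists_insert (hn 0)
    exact ⟨K', lam', h', ⟨(piFinSuccAddEquiv n).symm.trans
      ((AddEquiv.prodCongr (AddEquiv.refl _) e).trans e')⟩⟩

/-- Every finite abelian group has an invariant factor decomposition. -/
lemma exists_invariant_factors (G : Type*) [CommGroup G] [Finite G] :
    ∃ (K : ℕ) (lam : Fin K → ℕ), (∀ j, 1 < lam j) ∧ (∀ j k : Fin K, j ≤ k → lam j ∣ lam k) ∧
      Nonempty (G ≃* Multiplicative (∀ j, ZMod (lam j))) := by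
  obtain ⟨ι, _, n, hn, ⟨e⟩⟩ := CommGroup.equiv_prod_multiplicative_zmod_of_finite G
  let σ := Fintype.equivFin ι
  obtain ⟨K, lam, h, ⟨e'⟩⟩ := exists_isDivChain_addEquiv (fun i => n (σ.symm i))
    fun i => zero_lt_one.trans (hn _)
  let e₁ : (∀ i, Multiplicative (ZMod (n i))) ≃* Multiplicative (∀ i, ZMod (n i)) :=
    (MulEquiv.piMultiplicative _).symm
  let e₂ : (∀ i, ZMod (n i)) ≃+ ∀ i, ZMod (n (σ.symm i)) :=
    { Equiv.piCongrLeft' (fun i => ZMod (n i)) σ with map_add' := fun _ _ => rfl }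
  let e₃ : (∀ j, ZMod (lam j)) ≃+ ∀ j, ZMod (lam (Fin.revPerm.symm j)) :=
    { Equiv.piCongrLeft' (fun i => ZMod (lam i)) Fin.revPerm with map_add' := fun _ _ => rfl }
  refine ⟨K, fun j => lam (Fin.revPerm.symm j), fun j => h.1 _, fun j k hjk => h.2 _ _ ?_,
    ⟨e.trans (e₁.trans (e₂.trans (e'.trans e₃)).toMultiplicative)⟩⟩
  simpa using hjk

end InvariantFactors

section TorsionRank

/-- The number of solutions of `x ^ t = 1` in `G`. -/
def torsionCount (G : Type*) [Monoid G] (t : ℕ) : ℕ := Nat.card {x : G // x ^ t = 1}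

lemma torsionCount_congr {G H : Type*} [Monoid G] [Monoid H] (e : G ≃* H) (t : ℕ) :
    torsionCount G t = torsionCount H t :=
  Nat.card_congr (e.toEquiv.subtypeEquiv fun x => by
    change x ^ t = 1 ↔ e x ^ t = 1
    rw [← map_pow, map_eq_one_iff e e.injective])

lemma torsionCount_pos (G : Type*) [Monoid G] [Finite G] (t : ℕ) : 0 < torsionCount G t := by
  have : Nonempty {x : G // x ^ t = 1} := ⟨⟨1, one_pow t⟩⟩
  exact Nat.card_pos

lemma torsionCount_le_card (G : Type*) [Monoid G] [Finite G] (t : ℕ) :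
    torsionCount G t ≤ Nat.card G :=
  Nat.card_le_card_of_injective _ Subtype.val_injective

lemma torsionCount_prod (G H : Type*) [Monoid G] [Monoid H] (t : ℕ) :
    torsionCount (G × H) t = torsionCount G t * torsionCount H t := by
  rw [torsionCount, torsionCount, torsionCount, ← Nat.card_prod]
  refine Nat.card_congr ⟨fun x => (⟨x.1.1, (Prod.ext_iff.1 x.2).1⟩, ⟨x.1.2, (Prod.ext_iff.1 x.2).2⟩),
    fun x => ⟨(x.1.1, x.2.1), Prod.ext x.1.2 x.2.2⟩, fun _ => rfl, fun _ => rfl⟩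

lemma torsionCount_pi {ι : Type*} [Fintype ι] (G : ι → Type*) [∀ i, Monoid (G i)] (t : ℕ) :
    torsionCount (∀ i, G i) t = ∏ i, torsionCount (G i) t := by
  simp only [torsionCount]
  rw [← Nat.card_pi]
  exact Nat.card_congr ⟨fun x i => ⟨x.1 i, congrFun x.2 i⟩,
    fun x => ⟨fun i => (x i).1, funext fun i => (x i).2⟩, fun _ => rfl, fun _ => rfl⟩

lemma torsionCount_of_isCyclic (G : Type*) [CommGroup G] [Finite G] [IsCyclic G] (t : ℕ) :
    torsionCount G t = (Nat.card G).gcd t := by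
  rw [← IsCyclic.card_powMonoidHom_ker]
  rfl

lemma torsionCount_pi_zmod {K : ℕ} {lam : Fin K → ℕ} (h : ∀ j, 0 < lam j) (t : ℕ) :
    torsionCount (Multiplicative (∀ j, ZMod (lam j))) t = ∏ j, (lam j).gcd t := by
  rw [torsionCount_congr (MulEquiv.piMultiplicative fun j => ZMod (lam j)), torsionCount_pi]
  refine Finset.prod_congr rfl fun j _ => ?_
  have : NeZero (lam j) := ⟨(h j).ne'⟩
  rw [torsionCount_of_isCyclic, Nat.card_eq_fintype_card, Fintype.card_multiplicative, ZMod.card]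

lemma gcd_prime_pow_succ {p : ℕ} (hp : p.Prime) (β n : ℕ) :
    n.gcd (p ^ (β + 1)) = n.gcd (p ^ β) * if p ^ (β + 1) ∣ n then p else 1 := by
  split_ifs with h
  · rw [Nat.gcd_eq_right h, Nat.gcd_eq_right ((pow_dvd_pow p β.le_succ).trans h), pow_succ]
  · rw [mul_one]
    obtain ⟨k, hk, hk'⟩ := (Nat.dvd_prime_pow hp).1 (Nat.gcd_dvd_right n (p ^ (β + 1)))
    have hkβ : k ≤ β := by
      by_contra! hlt
      obtain rfl : k = β + 1 := by omega
      exact h (hk' ▸ Nat.gcd_dvd_left n (p ^ (β + 1)))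
    refine Nat.dvd_antisymm (Nat.dvd_gcd (Nat.gcd_dvd_left _ _) ?_)
      (Nat.gcd_dvd_gcd_of_dvd_right _ (pow_dvd_pow p β.le_succ))
    rw [hk']
    exact pow_dvd_pow p hkβ

/-- `G` has exactly `r` cyclic factors of order divisible by `p ^ (β + 1)`, expressed through
the numbers of solutions of `x ^ p ^ (β + 1) = 1` and `x ^ p ^ β = 1`. -/
def HasTorsionRank (G : Type*) [Monoid G] (p β r : ℕ) : Prop :=
  torsionCount G (p ^ (β + 1)) = torsionCount G (p ^ β) * p ^ r

lemma HasTorsionRank.congr {G H : Type*} [Monoid G] [Monoid H] (e : G ≃* H) {p β r : ℕ}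
    (h : HasTorsionRank G p β r) : HasTorsionRank H p β r := by
  unfold HasTorsionRank at *
  rwa [torsionCount_congr e, torsionCount_congr e] at h

lemma HasTorsionRank.prod {G H : Type*} [Monoid G] [Monoid H] {p β r s : ℕ}
    (h : HasTorsionRank G p β r) (h' : HasTorsionRank H p β s) :
    HasTorsionRank (G × H) p β (r + s) := by
  unfold HasTorsionRank at *
  rw [torsionCount_prod, torsionCount_prod, h, h', pow_add]
  ring

lemma HasTorsionRank.unique {G : Type*} [Monoid G] [Finite G] {p β r s : ℕ} (hp : p.Prime)
    (h : HasTorsionRank G p β r) (h' : HasTorsionRank G p β s) : r = s :=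
  Nat.pow_right_injective hp.two_le
    (Nat.eq_of_mul_eq_mul_left (torsionCount_pos G (p ^ β)) (h.symm.trans h'))

lemma hasTorsionRank_pi_zmod {K : ℕ} {lam : Fin K → ℕ} (h : ∀ j, 0 < lam j) {p : ℕ}
    (hp : p.Prime) (β : ℕ) :
    HasTorsionRank (Multiplicative (∀ j, ZMod (lam j))) p β
      (Finset.univ.filter fun j => p ^ (β + 1) ∣ lam j).card := by
  unfold HasTorsionRank
  rw [torsionCount_pi_zmod h, torsionCount_pi_zmod h,
    Finset.prod_congr rfl fun j _ => gcd_prime_pow_succ hp β (lam j), Finset.prod_mul_distrib,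
    Finset.prod_ite, Finset.prod_const, Finset.prod_const_one, mul_one]

lemma exists_hasTorsionRank (G : Type*) [CommGroup G] [Finite G] {p : ℕ} (hp : p.Prime) (β : ℕ) :
    ∃ r, HasTorsionRank G p β r := by
  obtain ⟨K, lam, h, -, ⟨e⟩⟩ := exists_invariant_factors G
  exact ⟨_, (hasTorsionRank_pi_zmod (fun j => zero_lt_one.trans (h j)) hp β).congr e.symm⟩

lemma hasTorsionRank_of_isCyclic (G : Type*) [CommGroup G] [Finite G] [IsCyclic G] {p : ℕ}
    (hp : p.Prime) (β : ℕ) :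
    HasTorsionRank G p β (if p ^ (β + 1) ∣ Nat.card G then 1 else 0) := by
  unfold HasTorsionRank
  rw [torsionCount_of_isCyclic, torsionCount_of_isCyclic, gcd_prime_pow_succ hp]
  split_ifs <;> simp

lemma omegaQ_prime_pow (q : ℕ) {ℓ k : ℕ} (hℓ : ℓ.Prime) (hk : 0 < k) :
    omegaQ (ℓ ^ k) q = if ℓ % q = 1 % q then 1 else 0 := by
  rw [omegaQ, Nat.primeFactors_prime_pow hk.ne' hℓ, Finset.filter_singleton]
  split_ifs <;> simp

lemma omegaQ_mul (q : ℕ) {a b : ℕ} (h : a.Coprime b) :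
    omegaQ (a * b) q = omegaQ a q + omegaQ b q := by
  rw [omegaQ, h.primeFactors_mul, Finset.filter_union, Finset.card_union_of_disjoint]
  · rfl
  · exact Finset.disjoint_filter_filter h.disjoint_primeFactors

lemma mod_eq_one_mod_iff {q ℓ : ℕ} (hℓ : 1 ≤ ℓ) : ℓ % q = 1 % q ↔ q ∣ ℓ - 1 :=
  ⟨fun h => (Nat.modEq_iff_dvd' hℓ).1 h.symm, fun h => ((Nat.modEq_iff_dvd' hℓ).2 h).symm⟩

lemma exists_hasTorsionRank_units_prime_pow {p β ℓ k : ℕ} (hp : p.Prime) (hℓ : ℓ.Prime)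
    (hk : 0 < k) :
    ∃ r, HasTorsionRank (ZMod (ℓ ^ k))ˣ p β r ∧ omegaQ (ℓ ^ k) (p ^ (β + 1)) ≤ r ∧
      r ≤ omegaQ (ℓ ^ k) (p ^ (β + 1)) + (if p ∣ ℓ ^ k then 1 else 0) +
        (ℓ ^ k).factorization 2 := by
  have : NeZero (ℓ ^ k) := ⟨pow_ne_zero _ hℓ.ne_zero⟩
  have hcard : Nat.card (ZMod (ℓ ^ k))ˣ = ℓ ^ (k - 1) * (ℓ - 1) := by
    rw [Nat.card_eq_fintype_card, ZMod.card_units_eq_totient, Nat.totient_prime_pow hℓ hk]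
  rw [omegaQ_prime_pow _ hℓ hk]
  simp only [mod_eq_one_mod_iff hℓ.one_le]
  have hpℓ : p ∣ ℓ ^ k ↔ p = ℓ :=
    ⟨fun h => (Nat.prime_dvd_prime_iff_eq hp hℓ).1 (hp.dvd_of_dvd_pow h),
      fun h => h ▸ dvd_pow_self p hk.ne'⟩
  rcases eq_or_ne ℓ 2 with rfl | hℓ2
  · obtain ⟨r, hr⟩ := exists_hasTorsionRank (ZMod (2 ^ k))ˣ hp β
    have h1 : ¬ p ^ (β + 1) ∣ 2 - 1 := by
      rw [Nat.dvd_one]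
      exact (Nat.one_lt_pow β.succ_ne_zero hp.one_lt).ne'
    refine ⟨r, hr, by simp [h1], ?_⟩
    rw [if_neg h1, Nat.Prime.factorization_pow Nat.prime_two, Finsupp.single_eq_same]
    have h2 : p ^ r ≤ 2 ^ (k - 1) := by
      calc p ^ r ≤ torsionCount (ZMod (2 ^ k))ˣ (p ^ β) * p ^ r :=
            Nat.le_mul_of_pos_left _ (torsionCount_pos _ _)
        _ = torsionCount (ZMod (2 ^ k))ˣ (p ^ (β + 1)) := hr.symm
        _ ≤ Nat.card (ZMod (2 ^ k))ˣ := torsionCount_le_card _ _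
        _ = 2 ^ (k - 1) := by rw [hcard]; simp
    have h3 : 2 ^ r ≤ 2 ^ (k - 1) := (Nat.pow_le_pow_left hp.two_le r).trans h2
    have := (Nat.pow_le_pow_iff_right (by norm_num : 1 < 2)).1 h3
    omega
  · have : IsCyclic (ZMod (ℓ ^ k))ˣ := ZMod.isCyclic_units_of_prime_pow ℓ hℓ hℓ2 k
    refine ⟨_, hasTorsionRank_of_isCyclic _ hp β, ?_, ?_⟩
    · rw [hcard]
      split_ifs with h1 h2
      · exact le_rfl
      · exact absurd (h1.mul_left _) h2
      · exact zero_le_one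
      · exact le_rfl
    · rw [hcard]
      rcases eq_or_ne p ℓ with h | h
      · rw [if_pos (hpℓ.2 h)]
        split_ifs <;> omega
      · have hcop : (p ^ (β + 1)).Coprime (ℓ ^ (k - 1)) :=
          Nat.Coprime.pow _ _ ((Nat.coprime_primes hp hℓ).2 h)
        simp only [hcop.dvd_mul_left]
        omega

/-- The rank of the `p`-part of `(ℤ/mℤ)ˣ` at level `p ^ (β + 1)` is close to the number of prime
divisors of `m` congruent to `1` modulo `p ^ (β + 1)`. -/
lemma exists_hasTorsionRank_units {p : ℕ} (hp : p.Prime) (β : ℕ) {m : ℕ} (hm : 0 < m) :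
    ∃ r, HasTorsionRank (ZMod m)ˣ p β r ∧ omegaQ m (p ^ (β + 1)) ≤ r ∧
      r ≤ omegaQ m (p ^ (β + 1)) + (if p ∣ m then 1 else 0) + m.factorization 2 := by
  induction m using Nat.recOnPosPrimePosCoprime with
  | prime_pow ℓ k hℓ hk => exact exists_hasTorsionRank_units_prime_pow hp hℓ hk
  | zero => exact absurd hm (lt_irrefl 0)
  | one =>
    refine ⟨0, ?_, by simp [omegaQ], by simp⟩
    have : ∀ t, torsionCount (ZMod 1)ˣ t = 1 := fun t => by
      rw [torsionCount_of_isCyclic]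
      simp
    rw [HasTorsionRank, this, this, pow_zero, mul_one]
  | coprime a b ha hb hab iha ihb =>
    obtain ⟨r, h1, h2, h3⟩ := iha (by omega)
    obtain ⟨s, h1', h2', h3'⟩ := ihb (by omega)
    let e : (ZMod (a * b))ˣ ≃* (ZMod a)ˣ × (ZMod b)ˣ :=
      (Units.mapEquiv (ZMod.chineseRemainder hab).toMulEquiv).trans MulEquiv.prodUnits
    refine ⟨r + s, (h1.prod h1').congr e.symm, ?_, ?_⟩
    · rw [omegaQ_mul _ hab]
      omega
    · rw [omegaQ_mul _ hab, Nat.factorization_mul (by omega) (by omega), Finsupp.add_apply]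
      have h4 : ¬ (p ∣ a ∧ p ∣ b) := fun h => by
        have := Nat.dvd_gcd h.1 h.2
        rw [hab] at this
        exact hp.one_lt.ne' (Nat.dvd_one.1 this)
      have h5 : p ∣ a * b ↔ p ∣ a ∨ p ∣ b := hp.dvd_mul
      simp only [h5]
      split_ifs at * <;> simp_all <;> omega

lemma card_filter_dvd_invariant_factors {m K : ℕ} (hm : 0 < m) {lam : Fin K → ℕ}
    (h : ∀ j, 0 < lam j) (e : (ZMod m)ˣ ≃* Multiplicative (∀ j, ZMod (lam j))) {q : ℕ}
    (hq : IsPrimePow q) :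
    omegaQ m q ≤ (Finset.univ.filter fun j => q ∣ lam j).card ∧
      (Finset.univ.filter fun j => q ∣ lam j).card ≤ omegaQ m q + (1 + m.factorization 2) := by
  obtain ⟨p, k, hp, hk, rfl⟩ := (isPrimePow_nat_iff q).1 hq
  obtain ⟨β, rfl⟩ : ∃ β, k = β + 1 := ⟨k - 1, by omega⟩
  have : NeZero m := ⟨hm.ne'⟩
  obtain ⟨r, h1, h2, h3⟩ := exists_hasTorsionRank_units hp β hm
  have h4 := h1.unique hp ((hasTorsionRank_pi_zmod h hp β).congr e.symm)
  rw [← h4]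
  refine ⟨h2, h3.trans ?_⟩
  split_ifs <;> omega

end TorsionRank

section DivisibilityChains

lemma exists_isPrimePow_dvd_not_dvd {a b : ℕ} (h : ¬ a ∣ b) :
    ∃ q, IsPrimePow q ∧ q ∣ a ∧ ¬ q ∣ b := by
  rw [Nat.dvd_iff_prime_pow_dvd_dvd] at h
  push Not at h
  obtain ⟨p, k, hp, h1, h2⟩ := h
  refine ⟨p ^ k, (isPrimePow_nat_iff _).2 ⟨p, k, hp, ?_, rfl⟩, h1, h2⟩
  rcases Nat.eq_zero_or_pos k with rfl | hk
  · simp at h2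
  · exact hk

variable {K : ℕ} {lam : Fin K → ℕ}

lemma card_eq_add_card_dvd_le_max (hchain : ∀ j k : Fin K, j ≤ k → lam j ∣ lam k) {d q q' : ℕ}
    (hq : q ∣ d) (hq' : ¬ q' ∣ d) :
    (Finset.univ.filter fun j => lam j = d).card + (Finset.univ.filter fun j => q' ∣ lam j).card ≤
      max (Finset.univ.filter fun j => q ∣ lam j).card
        (Finset.univ.filter fun j => q' ∣ lam j).card := by
  by_cases hex : ∃ j, lam j = d
  · obtain ⟨j, hj⟩ := hex
    refine le_max_of_le_left ?_
    rw [← Finset.card_union_of_disjoint]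
    · refine Finset.card_le_card fun k hk => ?_
      simp only [Finset.mem_union, Finset.mem_filter, Finset.mem_univ, true_and] at hk ⊢
      rcases hk with hk | hk
      · rwa [hk]
      · rcases le_total k j with hkj | hjk
        · exact absurd (hk.trans ((hchain _ _ hkj).trans hj.dvd)) hq'
        · exact (hq.trans hj.symm.dvd).trans (hchain _ _ hjk)
    · rw [Finset.disjoint_filter]
      rintro k - rfl
      exact hq'
  · push Not at hex
    rw [Finset.filter_false_of_mem fun j _ => hex j]
    simp

lemma exists_card_dvd_le (hchain : ∀ j k : Fin K, j ≤ k → lam j ∣ lam k) {d : ℕ} (hd : 1 < d) :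
    ∃ q, IsPrimePow q ∧ q ∣ d ∧ (Finset.univ.filter fun j => q ∣ lam j).card ≤
      (Finset.univ.filter fun j => d ∣ lam j).card := by
  by_cases h : (Finset.univ.filter fun j => ¬ d ∣ lam j).Nonempty
  · set j₀ := (Finset.univ.filter fun j => ¬ d ∣ lam j).max' h with hj₀
    have hmem := Finset.max'_mem _ h
    obtain ⟨q, h1, h2, h3⟩ := exists_isPrimePow_dvd_not_dvd (Finset.mem_filter.1 hmem).2
    refine ⟨q, h1, h2, Finset.card_le_card fun k hk => ?_⟩
    simp only [Finset.mem_filter, Finset.mem_univ, true_and] at hk ⊢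
    by_contra hdk
    have : k ≤ j₀ := Finset.le_max' _ _ (by simpa using hdk)
    exact h3 (hk.trans (hchain _ _ this))
  · have hall : ∀ j, d ∣ lam j := by
      simpa [Finset.not_nonempty_iff_eq_empty, Finset.filter_eq_empty_iff] using h
    have hp := Nat.minFac_prime hd.ne'
    refine ⟨d.minFac, hp.isPrimePow, d.minFac_dvd, ?_⟩
    rw [Finset.filter_true_of_mem (p := fun j => d ∣ lam j) fun j _ => hall j]
    exact Finset.card_filter_le _ _

lemma exists_card_dvd_le_card_eq_add (hchain : ∀ j k : Fin K, j ≤ k → lam j ∣ lam k) {d : ℕ}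
    (hd : 1 < d) :
    ∃ q, IsPrimePow q ∧ q ∣ d ∧
      ((Finset.univ.filter fun j => q ∣ lam j).card ≤
          (Finset.univ.filter fun j => lam j = d).card ∨
        ∃ q', IsPrimePow q' ∧ ¬ q' ∣ d ∧ (Finset.univ.filter fun j => q ∣ lam j).card ≤
          (Finset.univ.filter fun j => lam j = d).card +
            (Finset.univ.filter fun j => q' ∣ lam j).card) := by
  obtain ⟨q, h1, h2, h3⟩ := exists_card_dvd_le hchain hd
  refine ⟨q, h1, h2, ?_⟩
  by_cases h : (Finset.univ.filter fun j => d ∣ lam j ∧ lam j ≠ d).Nonempty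
  · right
    set j₁ := (Finset.univ.filter fun j => d ∣ lam j ∧ lam j ≠ d).min' h with hj₁
    have hmem := (Finset.mem_filter.1 (Finset.min'_mem _ h)).2
    obtain ⟨q', h1', h2', h3'⟩ := exists_isPrimePow_dvd_not_dvd
      (fun hdvd => hmem.2 (Nat.dvd_antisymm hdvd hmem.1))
    refine ⟨q', h1', h3', h3.trans ((Finset.card_le_card fun k hk => ?_).trans
      (Finset.card_union_le _ _))⟩
    simp only [Finset.mem_union, Finset.mem_filter, Finset.mem_univ, true_and] at hk ⊢
    by_cases hkd : lam k = d
    · exact Or.inl hkd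
    · have : j₁ ≤ k := Finset.min'_le _ _ (by simp [hk, hkd])
      exact Or.inr (h2'.trans (hchain _ _ this))
  · left
    refine h3.trans (Finset.card_le_card fun k hk => ?_)
    have hall : ∀ j, d ∣ lam j → lam j = d := by
      simpa [Finset.not_nonempty_iff_eq_empty, Finset.filter_eq_empty_iff] using h
    simp only [Finset.mem_filter, Finset.mem_univ, true_and] at hk ⊢
    exact hall k hk

end DivisibilityChains

section PrimePowerOrder

lemma IsPrimePow.le_two_mul_totient {q : ℕ} (hq : IsPrimePow q) : q ≤ 2 * q.totient := by
  obtain ⟨p, k, hp, hk, rfl⟩ := (isPrimePow_nat_iff _).1 hq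
  rw [Nat.totient_prime_pow hp hk]
  obtain ⟨k, rfl⟩ := Nat.exists_eq_succ_of_ne_zero hk.ne'
  rw [pow_succ, Nat.succ_sub_one, mul_left_comm]
  exact Nat.mul_le_mul_left _ (by have := hp.two_le; omega)

lemma totient_le_of_ppKey_le {q q' : ℕ} (hq' : IsPrimePow q') (h : ppKey q ≤ ppKey q') :
    q.totient ≤ q'.totient := by
  by_contra! hlt
  have h1 := hq'.le_two_mul_totient
  unfold ppKey at h
  nlinarith

lemma ppKey_injOn {q q' : ℕ} (hq : IsPrimePow q) (hq' : IsPrimePow q')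
    (h : ppKey q = ppKey q') : q = q' := by
  have h1 := (totient_le_of_ppKey_le hq' h.le).antisymm (totient_le_of_ppKey_le hq h.ge)
  simpa [ppKey, h1] using h

lemma ppKey_le_of_dvd {q q' : ℕ} (hq' : IsPrimePow q') (h : q ∣ q') : ppKey q ≤ ppKey q' := by
  have h1 := Nat.le_of_dvd (Nat.totient_pos.2 hq'.pos) (Nat.totient_dvd_of_dvd h)
  have h2 := Nat.le_of_dvd hq'.pos h
  unfold ppKey
  gcongr

lemma totient_lt_of_dvd {q q' : ℕ} (hq : IsPrimePow q) (hq' : IsPrimePow q') (h : q ∣ q')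
    (hne : q ≠ q') : q.totient < q'.totient := by
  obtain ⟨p, l, hp, hl, rfl⟩ := (isPrimePow_nat_iff _).1 hq'
  obtain ⟨k, hkl, rfl⟩ := (Nat.dvd_prime_pow hp).1 h
  have hk : 0 < k := by
    rcases Nat.eq_zero_or_pos k with rfl | hk
    · exact absurd hq (by simpa using not_isPrimePow_one)
    · exact hk
  have hlt : k < l := lt_of_le_of_ne hkl (by rintro rfl; exact hne rfl)
  rw [Nat.totient_prime_pow hp hk, Nat.totient_prime_pow hp hl]
  exact Nat.mul_lt_mul_of_pos_right (Nat.pow_lt_pow_right hp.one_lt (by omega))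
    (by have := hp.two_le; omega)

lemma infinite_ppKey : {k | ∃ q : ℕ, IsPrimePow q ∧ ppKey q = k}.Infinite := by
  refine Set.infinite_of_forall_exists_gt fun n => ?_
  obtain ⟨p, hnp, hp⟩ := Nat.exists_infinite_primes (n + 1)
  refine ⟨ppKey p, ⟨p, hp.isPrimePow, rfl⟩, ?_⟩
  unfold ppKey
  omega

lemma qt_spec (i : ℕ) : IsPrimePow (qt i) ∧ ppKey (qt i) = ppNthKey (i - 1) :=
  Nat.sInf_mem (s := {q : ℕ | IsPrimePow q ∧ ppKey q = ppNthKey (i - 1)})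
    (Nat.nth_mem_of_infinite infinite_ppKey (i - 1))

lemma ppKey_qt_le_iff {i j : ℕ} (hi : 1 ≤ i) (hj : 1 ≤ j) :
    ppKey (qt i) ≤ ppKey (qt j) ↔ i ≤ j := by
  rw [(qt_spec i).2, (qt_spec j).2, ppNthKey, ppNthKey, Nat.nth_le_nth infinite_ppKey]
  omega

lemma totient_qt_le {i j : ℕ} (hi : 1 ≤ i) (h : i ≤ j) :
    (qt i).totient ≤ (qt j).totient :=
  totient_le_of_ppKey_le (qt_spec j).1 ((ppKey_qt_le_iff hi (hi.trans h)).2 h)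

lemma exists_qt_eq {q : ℕ} (hq : IsPrimePow q) : ∃ j, 1 ≤ j ∧ qt j = q := by
  classical
  refine ⟨Nat.count (fun k => ∃ q : ℕ, IsPrimePow q ∧ ppKey q = k) (ppKey q) + 1, by omega,
    ppKey_injOn (qt_spec _).1 hq ?_⟩
  rw [(qt_spec _).2, ppNthKey, Nat.add_sub_cancel]
  exact Nat.nth_count (p := fun k => ∃ q : ℕ, IsPrimePow q ∧ ppKey q = k) ⟨q, hq, rfl⟩

lemma IsPrimePow.dvd_or_dvd_of_dvd_lcm {q a b : ℕ} (hq : IsPrimePow q) (h : q ∣ Nat.lcm a b) :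
    q ∣ a ∨ q ∣ b := by
  rcases Nat.eq_zero_or_pos a with rfl | ha
  · simp
  rcases Nat.eq_zero_or_pos b with rfl | hb
  · simp
  obtain ⟨p, k, hp, hk, rfl⟩ := (isPrimePow_nat_iff _).1 hq
  rw [hp.pow_dvd_iff_le_factorization (Nat.lcm_ne_zero ha.ne' hb.ne'),
    Nat.factorization_lcm ha.ne' hb.ne', Finsupp.sup_apply, le_sup_iff] at h
  rwa [hp.pow_dvd_iff_le_factorization ha.ne', hp.pow_dvd_iff_le_factorization hb.ne']

lemma qt_dvd_qt_le {i j : ℕ} (hi : 1 ≤ i) (hj : 1 ≤ j) (h : qt i ∣ qt j) : i ≤ j :=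
  (ppKey_qt_le_iff hi hj).1 (ppKey_le_of_dvd (qt_spec j).1 h)

lemma Lseq_zero : Lseq 0 = 1 := by simp [Lseq]

lemma Lseq_succ (i : ℕ) : Lseq (i + 1) = Nat.lcm (qt (i + 1)) (Lseq i) := by
  rw [Lseq, Lseq, ← Finset.insert_Icc_right_eq_Icc_add_one (by omega), Finset.lcm_insert]
  rfl

lemma Lseq_pos (i : ℕ) : 0 < Lseq i := by
  induction i with
  | zero => simp [Lseq_zero]
  | succ i ih => rw [Lseq_succ]; exact Nat.lcm_pos (qt_spec _).1.pos ih

lemma qt_dvd_Lseq_iff {i j : ℕ} (hj : 1 ≤ j) : qt j ∣ Lseq i ↔ j ≤ i := by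
  constructor
  · induction i with
    | zero =>
      rw [Lseq_zero, Nat.dvd_one]
      exact fun h => absurd h (qt_spec j).1.ne_one
    | succ i ih =>
      rw [Lseq_succ]
      intro h
      rcases (qt_spec j).1.dvd_or_dvd_of_dvd_lcm h with h | h
      · exact qt_dvd_qt_le hj (by omega) h
      · exact (ih h).trans i.le_succ
  · exact fun h => Finset.dvd_lcm (Finset.mem_Icc.2 ⟨hj, h⟩)

lemma one_lt_of_mem_UFO_and_totient_bounds {i d : ℕ} (hi : 1 ≤ i) (hd : d ∈ UFO i) :
    1 < d ∧
      (∀ q, IsPrimePow q → q ∣ d → q.totient ≤ (qt i).totient) ∧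
      (∃ q, IsPrimePow q ∧ q ∣ d ∧ q.totient = (qt i).totient) ∧
      (∀ q, IsPrimePow q → ¬ q ∣ d → (qt (i + 1)).totient ≤ q.totient) ∧
      ∃ q, IsPrimePow q ∧ ¬ q ∣ d ∧ q.totient = (qt (i + 1)).totient := by
  have hmain : (∀ q, IsPrimePow q → q ∣ d → q.totient ≤ (qt i).totient) ∧
      (∃ q, IsPrimePow q ∧ q ∣ d ∧ q.totient = (qt i).totient) ∧
      (∀ q, IsPrimePow q → ¬ q ∣ d → (qt (i + 1)).totient ≤ q.totient) ∧
      (∃ q, IsPrimePow q ∧ ¬ q ∣ d ∧ q.totient = (qt (i + 1)).totient) ∧ 0 < d := by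
    have hL : d = Lseq i ∨ (qt i).totient = (qt (i + 1)).totient ∧
        d = Nat.lcm (Lseq (i - 1)) (qt (i + 1)) := by
      unfold UFO at hd
      split_ifs at hd with h
      · exact Or.inl hd
      · rcases hd with hd | hd
        · exact Or.inl hd
        · exact Or.inr ⟨(totient_qt_le hi i.le_succ).antisymm (not_lt.1 h), hd⟩
    rcases hL with rfl | ⟨heq, rfl⟩
    · refine ⟨fun q hq hqd => ?_, ⟨qt i, (qt_spec i).1, (qt_dvd_Lseq_iff hi).2 le_rfl, rfl⟩,
        fun q hq hqd => ?_, ⟨qt (i + 1), (qt_spec _).1, ?_, rfl⟩, Lseq_pos i⟩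
      · obtain ⟨j, hj, rfl⟩ := exists_qt_eq hq
        exact totient_qt_le hj ((qt_dvd_Lseq_iff hj).1 hqd)
      · obtain ⟨j, hj, rfl⟩ := exists_qt_eq hq
        rw [qt_dvd_Lseq_iff hj] at hqd
        exact totient_qt_le (by omega) (by omega)
      · rw [qt_dvd_Lseq_iff (by omega)]
        omega
    · refine ⟨fun q hq hqd => ?_, ⟨qt (i + 1), (qt_spec _).1, Nat.dvd_lcm_right _ _, heq.symm⟩,
        fun q hq hqd => ?_, ⟨qt i, (qt_spec i).1, fun hqd => ?_, heq⟩,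
        Nat.lcm_pos (Lseq_pos _) (qt_spec _).1.pos⟩
      · obtain ⟨j, hj, rfl⟩ := exists_qt_eq hq
        rw [heq]
        refine totient_qt_le hj ?_
        rcases hq.dvd_or_dvd_of_dvd_lcm hqd with h | h
        · exact ((qt_dvd_Lseq_iff hj).1 h).trans (by omega)
        · exact qt_dvd_qt_le hj (by omega) h
      · obtain ⟨j, hj, rfl⟩ := exists_qt_eq hq
        rw [← heq]
        refine totient_qt_le hi ?_
        by_contra hji
        exact hqd (((qt_dvd_Lseq_iff hj).2 (by omega)).trans (Nat.dvd_lcm_left _ _))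
      · rcases (qt_spec i).1.dvd_or_dvd_of_dvd_lcm hqd with h | h
        · have := (qt_dvd_Lseq_iff hi).1 h
          omega
        · refine (totient_lt_of_dvd (qt_spec _).1 (qt_spec _).1 h fun h' => ?_).ne heq
          have := qt_dvd_qt_le (by omega) hi h'.symm.dvd
          omega
  obtain ⟨h1, ⟨q, hq, hqd, hqt⟩, h3, h4, hpos⟩ := hmain
  exact ⟨hq.one_lt.trans_le (Nat.le_of_dvd hpos hqd), h1, ⟨q, hq, hqd, hqt⟩, h3, h4⟩

end PrimePowerOrder

section Tail

lemma omegaQ_eq_zero_of_lt {m q : ℕ} (hm : 1 ≤ m) (h : m < q) : omegaQ m q = 0 := by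
  rw [omegaQ, Finset.card_eq_zero, Finset.filter_eq_empty_iff]
  intro p hp hmod
  have hpp := Nat.prime_of_mem_primeFactors hp
  have hpm := Nat.le_of_dvd hm (Nat.dvd_of_mem_primeFactors hp)
  rw [Nat.mod_eq_of_lt (by omega), Nat.mod_eq_of_lt (by omega)] at hmod
  exact hpp.ne_one hmod

lemma natCast_sub_le_exp_pow_sub_one_mul {c A : ℝ} (hc : 1 ≤ c) (hA : 0 ≤ A) (X : ℕ) :
    (X : ℝ) - A ≤ (Real.exp c ^ X - 1) * Real.exp (-(c * A)) := by
  rcases le_or_gt (X : ℝ) A with h | h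
  · have : 1 ≤ Real.exp c ^ X := one_le_pow₀ (Real.one_le_exp (by linarith))
    have := mul_nonneg (by linarith : 0 ≤ Real.exp c ^ X - 1) (Real.exp_pos (-(c * A))).le
    linarith
  · rw [sub_mul, one_mul, ← Real.exp_nat_mul, ← Real.exp_add]
    have h1 := Real.add_one_le_exp (X * c + -(c * A))
    have h2 : Real.exp (-(c * A)) ≤ 1 := Real.exp_le_one_iff.2 (by nlinarith)
    nlinarith

lemma exp_sub_one_le {x B : ℝ} (hx : 0 ≤ x) (hxB : x ≤ B) :
    Real.exp x - 1 ≤ x * Real.exp B := by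
  have h1 := Real.add_one_le_exp (-x)
  have h2 := Real.exp_pos x
  have h3 : Real.exp (-x) * Real.exp x = 1 := by rw [← Real.exp_add]; simp
  have h4 : Real.exp x ≤ Real.exp B := Real.exp_le_exp.2 hxB
  nlinarith

lemma mul_log_le {c y : ℝ} (hc : 0 < c) (hy : 0 < y) :
    c * Real.log y ≤ y + c * Real.log c := by
  have h := Real.log_le_sub_one_of_pos (div_pos hy hc)
  rw [Real.log_div hy.ne' hc.ne'] at h
  have h2 := mul_le_mul_of_nonneg_left h hc.le
  have h3 : c * (y / c - 1) = y - c := by field_simp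
  nlinarith

/-- The moment generating function of `omegaQ · q` over the large prime powers `q`. -/
lemma exists_exp_recipSum_sub_one_le {w : ℝ} (hw : 0 < w) :
    ∃ C : ℝ, 0 ≤ C ∧ ∀ n : ℕ, 3 ≤ n → ∀ q : ℕ, IsPrimePow q → 2 * w ≤ q.totient →
      Real.exp (w * recipSum q n) - 1 ≤
        C * (Real.log n / q + if (q : ℝ) ≤ Real.log n then Real.log n ^ 2 else 0) := by
  refine ⟨2 * w * Real.exp (w * 2) + Real.exp (5 + w * Real.log w + 8 * w), by positivity,
    fun n hn q hq hqw => ?_⟩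
  have hE := one_lt_log hn
  have hLL := LL_pos hn
  have hq2 := hq.two_le
  have hq0 : (0 : ℝ) < q := by positivity
  set C₁ := 2 * w * Real.exp (w * 2) with hC₁
  set C₂ := Real.exp (5 + w * Real.log w + 8 * w) with hC₂
  have hC₁0 : 0 ≤ C₁ := by positivity
  have hC₂0 : 0 ≤ C₂ := by positivity
  have hS := recipSum_nonneg q n
  split_ifs with hqE
  · have h1 := recipSum_le hq2 hn
    have hφ : (0 : ℝ) < q.totient := by linarith
    have h2 : w * (LL n / q.totient) ≤ LL n := by
      rw [mul_div_assoc', div_le_iff₀ hφ]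
      nlinarith
    have hlq : 0 ≤ Real.log q := Real.log_nonneg (by exact_mod_cast hq.one_lt.le)
    have h3 : Real.log q ≤ LL n := Real.log_le_log hq0 hqE
    have h4 := mul_log_le hw (by linarith : 0 < 5 + Real.log q)
    have h5 : w * recipSum q n ≤ (5 + w * Real.log w + 8 * w) + 2 * LL n := by nlinarith
    have h6 : Real.exp (w * recipSum q n) ≤ C₂ * Real.log n ^ 2 := by
      refine (Real.exp_le_exp.2 h5).trans (le_of_eq ?_)
      rw [Real.exp_add (5 + w * Real.log w + 8 * w), two_mul, Real.exp_add (LL n), LL,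
        Real.exp_log (by linarith), sq]
    have h7 : 0 ≤ (C₁ + C₂) * (Real.log n / q) := by positivity
    nlinarith [mul_nonneg hC₁0 (sq_nonneg (Real.log n))]
  · have h1 : recipSum q n ≤ 2 * (Real.log n / q) := by
      refine (recipSum_le_div hq2 n).trans ?_
      rw [mul_div_assoc']
      gcongr
      linarith
    have h2 : Real.log n / q ≤ 1 := (div_le_one hq0).2 (not_le.1 hqE).le
    have h3 := exp_sub_one_le (mul_nonneg hw.le hS) (mul_le_mul_of_nonneg_left
      (by linarith : recipSum q n ≤ 2) hw.le)
    have h4 : w * recipSum q n * Real.exp (w * 2) ≤ C₁ * (Real.log n / q) := by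
      have := mul_le_mul_of_nonneg_left h1 (by positivity : 0 ≤ w * Real.exp (w * 2))
      linarith
    have h7 : 0 ≤ C₂ * (Real.log n / q) := by positivity
    linarith

lemma sum_log_div_add_le {n : ℕ} (hn : 3 ≤ n) :
    ∑ q ∈ Finset.Icc 1 n,
      (Real.log n / q + if (q : ℝ) ≤ Real.log n then Real.log n ^ 2 else 0) ≤
        3 * Real.log n ^ 3 := by
  have hE := one_lt_log hn
  have h1 : ∑ q ∈ Finset.Icc 1 n, Real.log n / q ≤ Real.log n * (1 + Real.log n) := by
    have := harmonic_le_one_add_log n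
    rw [harmonic_eq_sum_Icc] at this
    push_cast at this
    simp_rw [div_eq_mul_inv]
    rw [← Finset.mul_sum]
    gcongr
  have h2 : (((Finset.Icc 1 n).filter fun q : ℕ => (q : ℝ) ≤ Real.log n).card : ℝ) ≤
      Real.log n := by
    refine le_trans ?_ (Nat.floor_le (by linarith : 0 ≤ Real.log n))
    rw [Nat.cast_le]
    refine (Finset.card_le_card (t := Finset.Icc 1 ⌊Real.log n⌋₊) fun q hq => ?_).trans
      (by simp)
    obtain ⟨h3, h4⟩ := Finset.mem_filter.1 hq
    exact Finset.mem_Icc.2 ⟨(Finset.mem_Icc.1 h3).1, Nat.le_floor h4⟩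
  rw [Finset.sum_add_distrib, ← Finset.sum_filter, Finset.sum_const, nsmul_eq_mul]
  have h3 := mul_le_mul_of_nonneg_right h2 (sq_nonneg (Real.log n))
  nlinarith [mul_pos (by linarith : 0 < Real.log n) (by linarith : 0 < Real.log n - 1),
    mul_pos (by positivity : 0 < Real.log n ^ 2) (by linarith : 0 < Real.log n - 1)]

/-- On average, no large prime power `q` makes `omegaQ · q` much exceed `LL n / b`. -/
lemma exists_sum_tail_le {b : ℕ} (hb : 1 ≤ b) :
    ∃ (Q : ℕ) (C : ℝ), ∀ n : ℕ, 3 ≤ n →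
      ∑ m ∈ Finset.Icc 1 n, ∑ q ∈ (Finset.Ioc Q n).filter IsPrimePow,
        (Real.exp (3 * b) ^ omegaQ m q - 1) * Real.exp (-(3 * b * (LL n / b))) ≤ C * n := by
  have hb0 : (0 : ℝ) < b := by positivity
  set w := Real.exp (3 * b) - 1 with hw
  have hw0 : 0 < w := by
    have := Real.add_one_le_exp (3 * b : ℝ)
    linarith
  obtain ⟨C, hC0, hC⟩ := exists_exp_recipSum_sub_one_le hw0
  refine ⟨⌈4 * w⌉₊, C * 3, fun n hn => ?_⟩
  have hE := one_lt_log hn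
  have hexp : Real.exp (-(3 * b * (LL n / b))) = (Real.log n ^ 3)⁻¹ := by
    rw [show 3 * b * (LL n / b) = 3 * LL n by field_simp, Real.exp_neg, LL,
      show (3 : ℝ) * Real.log (Real.log n) = ((3 : ℕ) : ℝ) * Real.log (Real.log n) by norm_num,
      Real.exp_nat_mul, Real.exp_log (by linarith)]
  rw [hexp, Finset.sum_comm]
  simp_rw [← Finset.sum_mul]
  rw [← div_eq_mul_inv, div_le_iff₀ (by positivity)]
  have h1 : ∀ q ∈ (Finset.Ioc ⌈4 * w⌉₊ n).filter IsPrimePow,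
      ∑ m ∈ Finset.Icc 1 n, (Real.exp (3 * b) ^ omegaQ m q - 1) ≤
        n * (C * (Real.log n / q + if (q : ℝ) ≤ Real.log n then Real.log n ^ 2 else 0)) := by
    intro q hq
    obtain ⟨hq1, hq2⟩ := Finset.mem_filter.1 hq
    have hwq : 2 * w ≤ q.totient := by
      have h2 : (⌈4 * w⌉₊ : ℝ) < q := by exact_mod_cast (Finset.mem_Ioc.1 hq1).1
      have h3 : (q : ℝ) ≤ 2 * q.totient := by exact_mod_cast hq2.le_two_mul_totient
      linarith [Nat.le_ceil (4 * w)]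
    have h2 := sum_pow_omegaQ_le q n (Real.one_le_exp (by positivity) : 1 ≤ Real.exp (3 * b))
    rw [Finset.sum_sub_distrib, Finset.sum_const, Nat.card_Icc, nsmul_eq_mul, mul_one,
      Nat.add_sub_cancel]
    have h3 := mul_le_mul_of_nonneg_left (hC n hn q hq2 hwq) n.cast_nonneg
    linarith
  refine (Finset.sum_le_sum h1).trans ?_
  rw [← Finset.mul_sum, ← Finset.mul_sum]
  have h2 : ∑ q ∈ (Finset.Ioc ⌈4 * w⌉₊ n).filter IsPrimePow,
      (Real.log n / q + if (q : ℝ) ≤ Real.log n then Real.log n ^ 2 else 0) ≤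
        3 * Real.log n ^ 3 := by
    refine le_trans (Finset.sum_le_sum_of_subset_of_nonneg (fun q hq => ?_) fun q _ _ => ?_)
      (sum_log_div_add_le hn)
    · have := Finset.mem_Ioc.1 (Finset.mem_filter.1 hq).1
      exact Finset.mem_Icc.2 ⟨by omega, this.2⟩
    · have : 0 ≤ Real.log n / q := by positivity
      split_ifs <;> positivity
  have h3 := mul_le_mul_of_nonneg_left h2 (by positivity : 0 ≤ n * C)
  linarith

end Tail

section Assembly

lemma exists_sum_abs_omegaQ_sub_le (q : ℕ) (hq : 0 < q) :
    ∃ C : ℝ, ∀ n : ℕ, 3 ≤ n →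
      ∑ m ∈ Finset.Icc 1 n, |(omegaQ m q : ℝ) - LL n / q.totient| ≤
        C * Real.sqrt (LL n) * n := by
  have : NeZero q := ⟨hq.ne'⟩
  obtain ⟨C, hC⟩ := exists_abs_recipSum_sub_le q
  set k := (Real.sqrt (LL 3))⁻¹ with hk
  refine ⟨Real.sqrt (3 * (1 + |C| * k)) + |C|, fun n hn => ?_⟩
  have hLL := LL_pos hn
  have hφ : (1 : ℝ) ≤ q.totient := by exact_mod_cast Nat.totient_pos.2 hq
  have hs := Real.sqrt_nonneg (LL n)
  have h1 : |recipSum q n - LL n / q.totient| ≤ |C| * Real.sqrt (LL n) :=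
    (hC n hn).trans (by gcongr; exact le_abs_self C)
  have h2 : Real.sqrt (LL n) ≤ k * LL n := by
    have := mul_le_mul_of_nonneg_right (one_le_sqrt_LL hn) hs
    rwa [one_mul, mul_assoc, Real.mul_self_sqrt hLL.le] at this
  have h3 : recipSum q n ≤ (1 + |C| * k) * LL n := by
    have h4 : LL n / q.totient ≤ LL n := div_le_self hLL.le hφ
    have h5 := mul_le_mul_of_nonneg_left h2 (abs_nonneg C)
    have := (abs_le.1 h1).2
    linarith
  have h4 : Real.sqrt (3 * recipSum q n) ≤
      Real.sqrt (3 * (1 + |C| * k)) * Real.sqrt (LL n) := by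
    rw [← Real.sqrt_mul (by positivity)]
    exact Real.sqrt_le_sqrt (by linarith)
  calc ∑ m ∈ Finset.Icc 1 n, |(omegaQ m q : ℝ) - LL n / q.totient|
      ≤ ∑ m ∈ Finset.Icc 1 n,
          (|(omegaQ m q : ℝ) - recipSum q n| + |recipSum q n - LL n / q.totient|) :=
        Finset.sum_le_sum fun m _ => abs_sub_le _ _ _
    _ = ∑ m ∈ Finset.Icc 1 n, |(omegaQ m q : ℝ) - recipSum q n| +
          n * |recipSum q n - LL n / q.totient| := by
        rw [Finset.sum_add_distrib, Finset.sum_const, Nat.card_Icc, nsmul_eq_mul,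
          Nat.add_sub_cancel]
    _ ≤ n * Real.sqrt (3 * recipSum q n) + n * (|C| * Real.sqrt (LL n)) := by
        gcongr
        exact sum_abs_omegaQ_sub_le q n
    _ ≤ n * (Real.sqrt (3 * (1 + |C| * k)) * Real.sqrt (LL n)) +
          n * (|C| * Real.sqrt (LL n)) := by gcongr
    _ = _ := by ring

/-- The pointwise comparison of an invariant factor count with its expected value. -/
lemma abs_invCount_sub_le {d a b q₀ q₁ Q M n m : ℕ} {J : ℕ → ℕ} (hJ : IsInvCount d J)
    (hd : 1 < d) (hm : m ∈ Finset.Icc 1 n) (hn : 3 ≤ n) (hb : 1 ≤ b)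
    (hle : 1 / (b : ℝ) ≤ 1 / a)
    (ha : ∀ q, IsPrimePow q → q ∣ d → q.totient ≤ a)
    (hq₀ : IsPrimePow q₀) (hq₀d : q₀ ∣ d) (hq₀a : q₀.totient = a)
    (hb' : ∀ q, IsPrimePow q → ¬ q ∣ d → b ≤ q.totient)
    (hq₁ : IsPrimePow q₁) (hq₁d : ¬ q₁ ∣ d) (hq₁b : q₁.totient = b)
    (hdM : d ≤ M) (hq₁M : q₁ ≤ M) (hQM : Q ≤ M) :
    |(J m : ℝ) - (1 / a - 1 / b) * LL n| ≤
      2 * ∑ q ∈ (Finset.Icc 1 M).filter IsPrimePow, |(omegaQ m q : ℝ) - LL n / q.totient| +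
        2 * (1 + m.factorization 2) +
        ∑ q ∈ (Finset.Ioc Q n).filter IsPrimePow,
          (Real.exp (3 * b) ^ omegaQ m q - 1) * Real.exp (-(3 * b * (LL n / b))) := by
  obtain ⟨hm1, hmn⟩ := Finset.mem_Icc.1 hm
  have hLL := LL_pos hn
  have hb0 : (1 : ℝ) ≤ b := by exact_mod_cast hb
  have : NeZero m := ⟨by omega⟩
  obtain ⟨K, lam, hlam, hchain, ⟨e⟩⟩ := exists_invariant_factors (ZMod m)ˣ
  rw [hJ m hm1 K lam hlam hchain ⟨e⟩]
  have hr := fun (q : ℕ) (hq : IsPrimePow q) =>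
    card_filter_dvd_invariant_factors hm1 (fun j => by have := hlam j; omega) e hq
  set D : ℕ → ℝ := fun q => |(omegaQ m q : ℝ) - LL n / q.totient| with hD
  have hD0 : ∀ q, 0 ≤ D q := fun q => abs_nonneg _
  set S := ∑ q ∈ (Finset.Icc 1 M).filter IsPrimePow, D q with hS
  set T := ∑ q ∈ (Finset.Ioc Q n).filter IsPrimePow,
    (Real.exp (3 * b) ^ omegaQ m q - 1) * Real.exp (-(3 * b * (LL n / b))) with hT
  have hT0 : ∀ q, 0 ≤ (Real.exp (3 * b) ^ omegaQ m q - 1) *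
      Real.exp (-(3 * b * (LL n / b))) := fun q => mul_nonneg
    (by linarith [one_le_pow₀ (n := omegaQ m q) (Real.one_le_exp (by positivity : 0 ≤ 3 * (b : ℝ)))])
    (Real.exp_pos _).le
  have hTnn : 0 ≤ T := Finset.sum_nonneg fun q _ => hT0 q
  have hDS : ∀ q, IsPrimePow q → q ≤ M → D q ≤ S := fun q hq hqM =>
    Finset.single_le_sum (fun q _ => hD0 q)
      (Finset.mem_filter.2 ⟨Finset.mem_Icc.2 ⟨hq.pos, hqM⟩, hq⟩)
  have hlow : ∀ q, LL n / q.totient - D q ≤ omegaQ m q := fun q => by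
    have := neg_abs_le ((omegaQ m q : ℝ) - LL n / q.totient)
    linarith
  have hupp : ∀ q, (omegaQ m q : ℝ) ≤ LL n / q.totient + D q := fun q => by
    have := le_abs_self ((omegaQ m q : ℝ) - LL n / q.totient)
    linarith
  have hS0 : 0 ≤ S := Finset.sum_nonneg fun q _ => hD0 q
  have hμ : (1 / (a : ℝ) - 1 / b) * LL n = LL n / a - LL n / b := by ring
  have hμ0 : 0 ≤ LL n / a - LL n / b := by
    rw [← hμ]
    exact mul_nonneg (by linarith) hLL.le
  have hb00 : 0 ≤ LL n / b := by positivity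
  set v : ℝ := (m.factorization 2 : ℝ) with hv
  have hv0 : 0 ≤ v := Nat.cast_nonneg _
  rw [hμ, abs_le]
  constructor
  · obtain ⟨q, hq, hqd, h⟩ := exists_card_dvd_le_card_eq_add hchain hd
    have hqa : LL n / a ≤ LL n / q.totient := by
      have : (q.totient : ℝ) ≤ a := by exact_mod_cast ha q hq hqd
      have : (0 : ℝ) < q.totient := by exact_mod_cast Nat.totient_pos.2 hq.pos
      gcongr
    have hqS := hDS q hq ((Nat.le_of_dvd (by omega) hqd).trans hdM)
    have hrq : (omegaQ m q : ℝ) ≤ _ := Nat.cast_le.2 (hr q hq).1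
    have hql := hlow q
    rcases h with h | ⟨q', hq', hq'd, h⟩
    · have h' : (_ : ℝ) ≤ _ := Nat.cast_le.2 h
      linarith
    · have h' : (_ : ℝ) ≤ _ := Nat.cast_le.2 h
      have hrq' : (_ : ℝ) ≤ _ := Nat.cast_le.2 (hr q' hq').2
      push_cast at h' hrq'
      have hω : (omegaQ m q' : ℝ) ≤ LL n / b + S + T := by
        rcases le_or_gt q' Q with hqQ | hqQ
        · have hqb : LL n / q'.totient ≤ LL n / b := by
            have : (b : ℝ) ≤ q'.totient := by exact_mod_cast hb' q' hq' hq'd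
            gcongr
          linarith [hupp q', hDS q' hq' (hqQ.trans hQM)]
        · rcases le_or_gt q' n with hqn | hqn
          · have h1 := natCast_sub_le_exp_pow_sub_one_mul (by linarith : 1 ≤ 3 * (b : ℝ)) hb00
              (omegaQ m q')
            have h2 := Finset.single_le_sum (fun q _ => hT0 q)
              (Finset.mem_filter.2 ⟨Finset.mem_Ioc.2 ⟨hqQ, hqn⟩, hq'⟩)
            linarith
          · rw [omegaQ_eq_zero_of_lt hm1 (by omega)]
            push_cast
            linarith
      linarith
  · have h := card_eq_add_card_dvd_le_max hchain hq₀d hq₁d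
    have h' : (_ : ℝ) ≤ _ := Nat.cast_le.2 h
    push_cast at h'
    have hr₀ : (_ : ℝ) ≤ _ := Nat.cast_le.2 (hr q₀ hq₀).2
    have hr₁ : (_ : ℝ) ≤ _ := Nat.cast_le.2 (hr q₁ hq₁).1
    push_cast at hr₀
    have h₀ := hupp q₀
    have h₁ := hlow q₁
    rw [hq₀a] at h₀
    rw [hq₁b] at h₁
    have hS₀ := hDS q₀ hq₀ ((Nat.le_of_dvd (by omega) hq₀d).trans hdM)
    have hS₁ := hDS q₁ hq₁ hq₁M
    rcases le_max_iff.1 h' with h' | h' <;> linarith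

end Assembly

theorem statement1 (i : ℕ) (hi : 1 ≤ i) (d : ℕ) (hd : d ∈ UFO i)
    (J : ℕ → ℕ) (hJ : IsInvCount d J) :
    ∃ C : ℝ, ∀ n : ℕ, 3 ≤ n →
      |avg J n - muSeq i * LL n| ≤ C * Real.sqrt (LL n) := by
  obtain ⟨hd1, ha, ⟨q₀, hq₀, hq₀d, hq₀a⟩, hb, q₁, hq₁, hq₁d, hq₁b⟩ :=
    one_lt_of_mem_UFO_and_totient_bounds hi hd
  have hb1 : 1 ≤ (qt (i + 1)).totient := Nat.totient_pos.2 (qt_spec _).1.pos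
  have ha1 : 1 ≤ (qt i).totient := Nat.totient_pos.2 (qt_spec _).1.pos
  have hle : 1 / ((qt (i + 1)).totient : ℝ) ≤ 1 / (qt i).totient := by
    have : ((qt i).totient : ℝ) ≤ (qt (i + 1)).totient := by
      exact_mod_cast totient_qt_le hi i.le_succ
    gcongr
  obtain ⟨Q, C, hC⟩ := exists_sum_tail_le hb1
  choose! B hB using exists_sum_abs_omegaQ_sub_le
  set M := d + q₁ + Q with hM
  set F := (Finset.Icc 1 M).filter IsPrimePow with hF
  refine ⟨2 * ∑ q ∈ F, B q + |4 + C| * (Real.sqrt (LL 3))⁻¹, fun n hn => ?_⟩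
  have hn0 : (0 : ℝ) < n := by positivity
  have hsum : ∑ m ∈ Finset.Icc 1 n, |(J m : ℝ) - muSeq i * LL n| ≤
      (2 * ∑ q ∈ F, B q) * Real.sqrt (LL n) * n + (4 + C) * n := by
    refine (Finset.sum_le_sum fun m hm => abs_invCount_sub_le (Q := Q) (M := M) hJ hd1 hm hn hb1
      hle ha hq₀ hq₀d hq₀a hb hq₁ hq₁d hq₁b (by omega) (by omega) (by omega)).trans ?_
    rw [Finset.sum_add_distrib, Finset.sum_add_distrib, ← Finset.mul_sum, ← Finset.mul_sum,
      Finset.sum_comm, Finset.sum_add_distrib, Finset.sum_const, Nat.card_Icc, nsmul_eq_mul]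
    have h1 : ∑ q ∈ F, ∑ m ∈ Finset.Icc 1 n, |(omegaQ m q : ℝ) - LL n / q.totient| ≤
        ∑ q ∈ F, B q * Real.sqrt (LL n) * n :=
      Finset.sum_le_sum fun q hq => hB q (Finset.mem_filter.1 hq).2.pos n hn
    rw [← Finset.sum_mul, ← Finset.sum_mul] at h1
    have h2 := sum_factorization_two_le n
    have h3 := hC n hn
    rw [Nat.add_sub_cancel]
    linarith
  have havg : avg J n - muSeq i * LL n =
      (∑ m ∈ Finset.Icc 1 n, ((J m : ℝ) - muSeq i * LL n)) / n := by
    rw [Finset.sum_sub_distrib, Finset.sum_const, Nat.card_Icc, nsmul_eq_mul,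
      Nat.add_sub_cancel, sub_div, mul_div_cancel_left₀ _ hn0.ne', avg]
  rw [havg, abs_div, abs_of_pos hn0, div_le_iff₀ hn0]
  refine (Finset.abs_sum_le_sum_abs _ _).trans (hsum.trans ?_)
  have h1 : 4 + C ≤ |4 + C| * ((Real.sqrt (LL 3))⁻¹ * Real.sqrt (LL n)) :=
    (le_abs_self _).trans (le_mul_of_one_le_right (abs_nonneg _) (one_le_sqrt_LL hn))
  have h2 := mul_le_mul_of_nonneg_right h1 hn0.le
  linarith

end
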